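/- arXiv:1402.3621 — 3 statements merged into one kernel-verified Lean document; each statement's English description precedes it below -/
import Mathlib

section
/- Let m be a positive integer which is a sum of two squares, E = {μ ∈ ℤ² : μ₁² + μ₂² = m}, N = #E, and let F be the arithmetic random wave associated to m. Let γ : [0,L] → ℝ² be a smooth unit-speed curve with nowhere-vanishing curvature and let Z = #{t ∈ [0,L] : F(γ(t)) = 0} be the number of nodal intersections. Then the expected number of nodal intersections equals E[Z] = √(2m) · L. -/
open MeasureTheory ProbabilityTheory Real

noncomputable section

/-- The set of lattice points on the circle of radius `√m`:
`E = {μ ∈ ℤ² : μ₁² + μ₂² = m}` (all solutions satisfy `|μᵢ| ≤ m`). -/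
def latticeSet (m : ℕ) : Finset (ℤ × ℤ) :=
  (Finset.Icc (-(m : ℤ)) (m : ℤ) ×ˢ Finset.Icc (-(m : ℤ)) (m : ℤ)).filter
    (fun μ => μ.1 ^ 2 + μ.2 ^ 2 = (m : ℤ))

/-- `N = #E`, the number of lattice points on the circle of radius `√m`. -/
def latN (m : ℕ) : ℕ := (latticeSet m).card

/-- The probability space of the arithmetic random wave: `ℝ^E × ℝ^E`. -/
abbrev WaveSpace (m : ℕ) : Type :=
  (↥(latticeSet m) → ℝ) × (↥(latticeSet m) → ℝ)

/-- The Gaussian probability measure of the arithmetic random wave: the product of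
standard Gaussian measures on `ℝ^E × ℝ^E`. -/
def waveMeasure (m : ℕ) : Measure (WaveSpace m) :=
  (Measure.pi fun _ : ↥(latticeSet m) => gaussianReal 0 1).prod
    (Measure.pi fun _ : ↥(latticeSet m) => gaussianReal 0 1)

/-- The arithmetic random wave
`F(x) = N^{-1/2} ∑_{μ ∈ E} (b_μ cos(2π⟨μ,x⟩) + c_μ sin(2π⟨μ,x⟩))`. -/
def wave (m : ℕ) (ω : WaveSpace m) (x : ℝ × ℝ) : ℝ :=
  (Real.sqrt (latN m))⁻¹ *
    ∑ μ : ↥(latticeSet m),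
      (ω.1 μ * Real.cos (2 * π * (((μ : ℤ × ℤ).1 : ℝ) * x.1 + ((μ : ℤ × ℤ).2 : ℝ) * x.2)) +
       ω.2 μ * Real.sin (2 * π * (((μ : ℤ × ℤ).1 : ℝ) * x.1 + ((μ : ℤ × ℤ).2 : ℝ) * x.2)))

/-- The number of nodal intersections of the wave with the curve `γ` on `[0, L]`. -/
def nodalCount (m : ℕ) (γ : ℝ → ℝ × ℝ) (L : ℝ) (ω : WaveSpace m) : ℕ :=
  Set.ncard {t : ℝ | t ∈ Set.Icc 0 L ∧ wave m ω (γ t) = 0}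

lemma map_inner_pair_stdGaussian {H : Type*} [NormedAddCommGroup H] [InnerProductSpace ℝ H]
    [FiniteDimensional ℝ H] [MeasurableSpace H] [BorelSpace H] {u w : H}
    (hu : ‖u‖ = 1) (hw : ‖w‖ = 1) (huw : inner ℝ u w = 0) :
    (stdGaussian H).map (fun x => (inner ℝ u x, inner ℝ w x)) =
      (gaussianReal 0 1).prod (gaussianReal 0 1) := by
  let T : H →L[ℝ] ℝ × ℝ := (innerSL ℝ u).prod (innerSL ℝ w)
  change (stdGaussian H).map T = _
  apply Measure.ext_of_charFunDual
  ext L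
  have key : L.comp T = innerSL ℝ (L (1, 0) • u + L (0, 1) • w) := by
    ext x
    have : T x = (inner ℝ u x) • ((1, 0) : ℝ × ℝ) + (inner ℝ w x) • ((0, 1) : ℝ × ℝ) := by
      simp [T]
    simp only [ContinuousLinearMap.comp_apply, this, map_add, map_smul, innerSL_apply_apply,
      smul_eq_mul, FunLike.coe_add, Pi.add_apply, FunLike.coe_smul, Pi.smul_apply]
    ring
  have hn : ‖L (1, 0) • u + L (0, 1) • w‖ ^ 2 = L (1, 0) ^ 2 + L (0, 1) ^ 2 := by
    rw [norm_add_sq_real, norm_smul, norm_smul, real_inner_smul_left, real_inner_smul_right, huw,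
      hu, hw]
    simp
  have h1 : (L.comp (.inl ℝ ℝ ℝ)) = innerSL ℝ (L (1, 0)) := by
    ext; simp
  have h2 : (L.comp (.inr ℝ ℝ ℝ)) = innerSL ℝ (L (0, 1)) := by
    ext; simp
  have hg (a : ℝ) : charFunDual (gaussianReal 0 1) (innerSL ℝ a) =
      Complex.exp (- (a ^ 2 : ℝ) / 2) := by
    rw [show innerSL ℝ a = InnerProductSpace.toDualMap ℝ ℝ a from rfl,
      ← charFun_eq_charFunDual_toDualMap, charFun_gaussianReal]
    simp [neg_div]
  rw [charFunDual_map, charFunDual_prod, charFunDual_stdGaussian, key, h1, h2, hg, hg,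
    ← Complex.exp_add, innerSL_apply_norm, ← Complex.ofReal_pow, hn]
  congr 1
  push_cast
  ring

lemma gaussianReal_Icc_le (a : ℝ) :
    gaussianReal 0 1 (Set.Icc (-a) a) ≤ ENNReal.ofReal (2 * a) := by
  rw [gaussianReal_apply 0 one_ne_zero]
  calc ∫⁻ x in Set.Icc (-a) a, gaussianPDF 0 1 x ≤ ∫⁻ x in Set.Icc (-a) a, 1 := by
        refine lintegral_mono fun x => ?_
        rw [gaussianPDF, gaussianPDFReal]
        rw [ENNReal.ofReal_le_one]
        refine mul_le_one₀ ?_ (by positivity) ?_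
        · apply inv_le_one_of_one_le₀
          rw [Real.one_le_sqrt]
          simp
          nlinarith [pi_gt_three]
        · rw [Real.exp_le_one_iff, neg_div]
          exact neg_nonpos.2 (by positivity)
    _ = _ := by
      rw [setLIntegral_one, Real.volume_Icc]
      congr 1
      ring

lemma stdGaussian_abs_inner_le {H : Type*} [NormedAddCommGroup H] [InnerProductSpace ℝ H]
    [FiniteDimensional ℝ H] [MeasurableSpace H] [BorelSpace H] {u w : H}
    (hu : ‖u‖ = 1) (hw : ‖w‖ = 1) (huw : inner ℝ u w = 0) {a b : ℝ} (ha : 0 ≤ a) :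
    stdGaussian H {x | |inner ℝ u x| ≤ a ∧ |inner ℝ w x| ≤ b} ≤ ENNReal.ofReal (4 * a * b) := by
  have : {x : H | |inner ℝ u x| ≤ a ∧ |inner ℝ w x| ≤ b} =
      (fun x => (inner ℝ u x, inner ℝ w x)) ⁻¹' (Set.Icc (-a) a ×ˢ Set.Icc (-b) b) := by
    ext x
    simp [abs_le, -Set.Icc_prod_Icc]
  rw [this, ← Measure.map_apply (by fun_prop) (measurableSet_Icc.prod measurableSet_Icc),
    map_inner_pair_stdGaussian hu hw huw, Measure.prod_prod]
  calc _ ≤ ENNReal.ofReal (2 * a) * ENNReal.ofReal (2 * b) :=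
        mul_le_mul' (gaussianReal_Icc_le a) (gaussianReal_Icc_le b)
    _ = _ := by rw [← ENNReal.ofReal_mul (by positivity)]; congr 1; ring

lemma stdGaussian_inner_eq_zero {H : Type*} [NormedAddCommGroup H] [InnerProductSpace ℝ H]
    [FiniteDimensional ℝ H] [MeasurableSpace H] [BorelSpace H] {u : H} (hu : ‖u‖ = 1) :
    stdGaussian H {x | inner ℝ u x = 0} = 0 := by
  have h : (stdGaussian H).map (innerSL ℝ u) = gaussianReal 0 1 := by
    rw [IsGaussian.map_eq_gaussianReal, integral_strongDual_stdGaussian, variance_dual_stdGaussian]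
    simp [hu]
  have : {x : H | inner ℝ u x = 0} = (innerSL ℝ u) ⁻¹' {0} := by ext; simp
  have := nullSingletonClass_gaussianReal (μ := 0) (v := 1) one_ne_zero
  rw [‹{x : H | _} = _›, ← Measure.map_apply (by fun_prop) (measurableSet_singleton 0), h,
    measure_singleton]

/-- The standard Gaussian measure of a planar cone is proportional to its opening angle. -/
lemma gaussian_prod_cone :
    ∃ K : ENNReal, ∀ C : Set (ℝ × ℝ), MeasurableSet C →
      (∀ r x y, 0 < r → ((r * x, r * y) ∈ C ↔ (x, y) ∈ C)) →
      (gaussianReal 0 1).prod (gaussianReal 0 1) C =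
        K * volume {θ ∈ Set.Ioo (-π) π | (cos θ, sin θ) ∈ C} := by
  refine ⟨∫⁻ r in Set.Ioi 0, ENNReal.ofReal r *
    ENNReal.ofReal ((√(2 * π))⁻¹ ^ 2 * rexp (-r ^ 2 / 2)), fun C hC hcone => ?_⟩
  have hA : MeasurableSet {θ | (cos θ, sin θ) ∈ C} :=
    hC.preimage (by fun_prop : Measurable fun θ : ℝ => (cos θ, sin θ))
  rw [gaussianReal_of_var_ne_zero _ one_ne_zero,
    prod_withDensity (measurable_gaussianPDF _ _) (measurable_gaussianPDF _ _),
    withDensity_apply _ hC, ← lintegral_indicator hC]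
  change ∫⁻ p : ℝ × ℝ, _ = _
  rw [← lintegral_comp_polarCoord_symm]
  have hvol : volume {θ ∈ Set.Ioo (-π) π | (cos θ, sin θ) ∈ C} =
      ∫⁻ θ in Set.Ioo (-π) π, Set.indicator {θ | (cos θ, sin θ) ∈ C} 1 θ := by
    rw [lintegral_indicator_one hA, Measure.restrict_apply hA, Set.inter_comm]
    rfl
  rw [hvol, ← lintegral_prod_mul (by fun_prop)
    ((measurable_one.indicator hA).aemeasurable), Measure.prod_restrict, polarCoord_target]
  refine setLIntegral_congr_fun (measurableSet_Ioi.prod measurableSet_Ioo) ?_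
  rintro ⟨r, θ⟩ ⟨hr, hθ⟩
  simp only [Set.mem_Ioi] at hr
  simp only [polarCoord_symm_apply, smul_eq_mul]
  by_cases hθC : (cos θ, sin θ) ∈ C
  · rw [Set.indicator_of_mem ((hcone r _ _ hr).2 hθC), Set.indicator_of_mem (by exact hθC),
      Pi.one_apply, mul_one, gaussianPDF, gaussianPDF, gaussianPDFReal, gaussianPDFReal,
      ← ENNReal.ofReal_mul (by positivity)]
    congr 2
    have : rexp (-r ^ 2 / 2) = rexp (-(r * cos θ) ^ 2 / 2) * rexp (-(r * sin θ) ^ 2 / 2) := by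
      rw [← Real.exp_add]; congr 1
      linear_combination (r ^ 2 / 2) * (sin_sq_add_cos_sq θ)
    rw [this]
    simp
    ring
  · rw [Set.indicator_of_notMem (mt (hcone r _ _ hr).1 hθC), Set.indicator_of_notMem (by exact hθC),
      mul_zero, mul_zero]

lemma gaussian_prod_cone_eq {C : Set (ℝ × ℝ)} (hC : MeasurableSet C)
    (hcone : ∀ r x y, 0 < r → ((r * x, r * y) ∈ C ↔ (x, y) ∈ C)) :
    (gaussianReal 0 1).prod (gaussianReal 0 1) C =
      volume {θ ∈ Set.Ioo (-π) π | (cos θ, sin θ) ∈ C} / ENNReal.ofReal (2 * π) := by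
  obtain ⟨K, hK⟩ := gaussian_prod_cone
  have h1 := hK Set.univ MeasurableSet.univ (by simp)
  have h2 : {θ | θ ∈ Set.Ioo (-π) π ∧ (cos θ, sin θ) ∈ Set.univ} = Set.Ioo (-π) π := by
    ext; simp
  rw [h2, measure_univ, Real.volume_Ioo, sub_neg_eq_add, ← two_mul] at h1
  rw [hK C hC hcone, ENNReal.div_eq_inv_mul, ← ENNReal.eq_inv_of_mul_eq_one_left h1.symm]

lemma cos_mul_cos_sub_neg_iff {φ θ : ℝ} (h0 : 0 ≤ φ) (h1 : φ ≤ π / 2)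
    (hθ : θ ∈ Set.Ioo (-π) π) :
    cos θ * cos (θ - φ) < 0 ↔
      θ ∈ Set.Ioo (-(π / 2)) (-(π / 2) + φ) ∪ Set.Ioo (π / 2) (π / 2 + φ) := by
  obtain ⟨ha, hb⟩ := hθ
  have hpos {x : ℝ} (h : -(π / 2) ≤ x) (h' : x ≤ π / 2) : 0 ≤ cos x :=
    cos_nonneg_of_mem_Icc ⟨h, h'⟩
  have hneg {x : ℝ} (h : π / 2 ≤ x) (h' : x ≤ π + π / 2) : cos x ≤ 0 :=
    cos_nonpos_of_pi_div_two_le_of_le h h'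
  have hneg' {x : ℝ} (h : -(π + π / 2) ≤ x) (h' : x ≤ -(π / 2)) : cos x ≤ 0 := by
    rw [← cos_neg]; exact hneg (by linarith) (by linarith)
  simp only [Set.mem_union, Set.mem_Ioo]
  constructor
  · intro h
    by_contra! hc
    refine absurd h (not_lt.2 ?_)
    rcases le_or_gt θ (-(π / 2)) with h3 | h3
    · exact mul_nonneg_of_nonpos_of_nonpos (hneg' (by linarith) h3)
        (hneg' (by linarith) (by linarith))
    · have h4 := hc.1 h3
      rcases le_or_gt θ (π / 2) with h5 | h5
      · exact mul_nonneg (hpos h3.le h5) (hpos (by linarith) (by linarith))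
      · have h6 := hc.2 h5
        exact mul_nonneg_of_nonpos_of_nonpos (hneg h5.le (by linarith))
          (hneg (by linarith) (by linarith))
  · rintro (⟨h3, h4⟩ | ⟨h3, h4⟩)
    · refine mul_neg_of_pos_of_neg (cos_pos_of_mem_Ioo ⟨h3, by linarith⟩) ?_
      rw [← cos_neg]
      exact cos_neg_of_pi_div_two_lt_of_lt (by linarith) (by linarith)
    · exact mul_neg_of_neg_of_pos (cos_neg_of_pi_div_two_lt_of_lt h3 (by linarith))
        (cos_pos_of_mem_Ioo ⟨by linarith, by linarith⟩)

lemma gaussian_prod_sign_change {φ : ℝ} (h0 : 0 ≤ φ) (h1 : φ ≤ π / 2) :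
    (gaussianReal 0 1).prod (gaussianReal 0 1)
      {p : ℝ × ℝ | p.1 * (cos φ * p.1 + sin φ * p.2) < 0} = ENNReal.ofReal (φ / π) := by
  rw [gaussian_prod_cone_eq (measurableSet_lt (by fun_prop) (by fun_prop))]
  · have : {θ | θ ∈ Set.Ioo (-π) π ∧ (cos θ, sin θ) ∈
        {p : ℝ × ℝ | p.1 * (cos φ * p.1 + sin φ * p.2) < 0}} =
        Set.Ioo (-(π / 2)) (-(π / 2) + φ) ∪ Set.Ioo (π / 2) (π / 2 + φ) := by
      ext θ
      have hc : cos φ * cos θ + sin φ * sin θ = cos (θ - φ) := by rw [cos_sub]; ring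
      simp only [Set.mem_ofPred_eq, hc]
      constructor
      · exact fun h => (cos_mul_cos_sub_neg_iff h0 h1 h.1).1 h.2
      · intro h
        have hm : θ ∈ Set.Ioo (-π) π := by
          rcases h with ⟨h, h'⟩ | ⟨h, h'⟩ <;> constructor <;> linarith [pi_pos]
        exact ⟨hm, (cos_mul_cos_sub_neg_iff h0 h1 hm).2 h⟩
    rw [this, measure_union _ measurableSet_Ioo, Real.volume_Ioo, Real.volume_Ioo,
      ← ENNReal.ofReal_add (by linarith) (by linarith), ← ENNReal.ofReal_div_of_pos (by positivity)]
    · congr 1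
      field_simp
      ring
    · rw [Set.disjoint_left]
      rintro x ⟨h, h'⟩ ⟨h2, h2'⟩
      linarith [pi_pos]
  · intro r x y hr
    simp only [Set.mem_ofPred_eq]
    have : r * x * (cos φ * (r * x) + sin φ * (r * y)) =
      r ^ 2 * (x * (cos φ * x + sin φ * y)) := by ring
    rw [this]
    exact ⟨fun h => neg_of_mul_neg_right h (by positivity),
      fun h => mul_neg_of_pos_of_neg (by positivity) h⟩

/-- The probability that a standard Gaussian vector is on different sides of the hyperplanes
orthogonal to two unit vectors is proportional to the angle between them. -/
lemma stdGaussian_sign_change {H : Type*} [NormedAddCommGroup H] [InnerProductSpace ℝ H]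
    [FiniteDimensional ℝ H] [MeasurableSpace H] [BorelSpace H] {u w : H}
    (hu : ‖u‖ = 1) (hw : ‖w‖ = 1) (huw : 0 ≤ inner ℝ u w) :
    stdGaussian H {x | inner ℝ u x * inner ℝ w x < 0} =
      ENNReal.ofReal (2 * arcsin (‖u - w‖ / 2) / π) := by
  have hd : ‖u - w‖ ^ 2 = 2 - 2 * inner ℝ u w := by
    rw [norm_sub_sq_real, hu, hw]; ring
  by_cases he : u = w
  · subst he
    have : {x : H | inner ℝ u x * inner ℝ u x < 0} = ∅ := by
      ext x
      simp [mul_self_nonneg]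
    simp [this]
  set φ := 2 * arcsin (‖u - w‖ / 2) with hφ
  have hd0 : 0 < ‖u - w‖ := norm_pos_iff.2 (sub_ne_zero.2 he)
  have hsin : sin (φ / 2) = ‖u - w‖ / 2 := by
    rw [hφ, mul_div_cancel_left₀ _ two_ne_zero, sin_arcsin] <;> nlinarith
  have hcos : cos φ = inner ℝ u w := by
    have := cos_two_mul (φ / 2)
    rw [mul_div_cancel₀ _ two_ne_zero] at this
    rw [this, cos_sq', hsin, div_pow, hd]; ring
  have h0 : 0 < φ := by
    rw [hφ]; have := arcsin_pos.2 (half_pos hd0); linarith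
  have hle : φ ≤ π := by have := arcsin_le_pi_div_two (‖u - w‖ / 2); linarith
  have h1 : φ ≤ π / 2 := by
    by_contra! h
    have := cos_neg_of_pi_div_two_lt_of_lt h (by linarith)
    linarith
  have hs : 0 < sin φ := sin_pos_of_pos_of_lt_pi h0 (by linarith [pi_pos])
  set e : H := (sin φ)⁻¹ • (w - cos φ • u) with he_def
  have hwe : w = cos φ • u + sin φ • e := by
    rw [he_def, smul_inv_smul₀ hs.ne']; abel
  have hue : inner ℝ u e = 0 := by
    rw [he_def, real_inner_smul_right, inner_sub_right, real_inner_smul_right,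
      real_inner_self_eq_norm_sq, hu, hcos]
    ring
  have hne : ‖e‖ = 1 := by
    have : ‖w‖ ^ 2 = cos φ ^ 2 + sin φ ^ 2 * ‖e‖ ^ 2 := by
      conv_lhs => rw [hwe]
      rw [norm_add_sq_real, norm_smul, norm_smul, real_inner_smul_left, real_inner_smul_right,
        hue, hu, mul_pow, mul_pow, norm_eq_abs, norm_eq_abs, sq_abs, sq_abs]
      ring
    rw [hw] at this
    have h2 : ‖e‖ ^ 2 = 1 := by
      have h3 : sin φ ^ 2 * (‖e‖ ^ 2 - 1) = 0 := by
        linear_combination (-1) * this - sin_sq_add_cos_sq φ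
      rcases mul_eq_zero.1 h3 with h4 | h4
      · exact absurd h4 (by positivity)
      · linarith
    nlinarith [norm_nonneg e]
  rw [← gaussian_prod_sign_change h0.le h1, ← map_inner_pair_stdGaussian hu hne hue,
    Measure.map_apply (by fun_prop) (measurableSet_lt (by fun_prop) (by fun_prop))]
  congr 1
  ext x
  simp only [Set.mem_ofPred_eq, Set.mem_preimage]
  conv_lhs => rw [hwe]
  rw [inner_add_left, real_inner_smul_left, real_inner_smul_left]

open Filter Topology

lemma HasDerivAt.eventually_mul_neg_of_eq_zero {f : ℝ → ℝ} {f' z : ℝ} (hf : HasDerivAt f f' z)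
    (hz : f z = 0) (hf' : f' ≠ 0) :
    ∀ᶠ h in 𝓝[>] (0 : ℝ), ∀ a b, z - h < a → a < z → z < b → b < z + h → f a * f b < 0 := by
  have h1 : ∀ᶠ x in 𝓝[≠] z, 0 < slope f z x * f' :=
    ((hasDerivAt_iff_tendsto_slope.1 hf).mul_const f').eventually
      (lt_mem_nhds (mul_self_pos.2 hf'))
  rw [eventually_nhdsWithin_iff, Metric.eventually_nhds_iff] at h1
  obtain ⟨δ, hδ, h1⟩ := h1
  filter_upwards [Ioo_mem_nhdsGT hδ] with h hh a b ha ha' hb hb'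
  have h2 := h1 (y := a) (by rw [Real.dist_eq, abs_lt]; constructor <;> linarith [hh.2]) ha'.ne
  have h3 := h1 (y := b) (by rw [Real.dist_eq, abs_lt]; constructor <;> linarith [hh.2]) hb.ne'
  rw [slope_def_field, hz, sub_zero] at h2 h3
  have h4 : 0 < f a * f b / ((a - z) * (b - z)) * f' ^ 2 := by
    have h5 := mul_pos h2 h3
    rwa [mul_mul_mul_comm, div_mul_div_comm, ← sq] at h5
  have h5 := pos_of_mul_pos_left h4 (sq_nonneg f')
  by_contra! h6
  have h7 : (a - z) * (b - z) < 0 := mul_neg_of_neg_of_pos (by linarith) (by linarith)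
  exact absurd h5 (not_lt.2 (div_nonpos_of_nonneg_of_nonpos h6 h7.le))

lemma finite_zeros_of_deriv_ne_zero {f : ℝ → ℝ} (hf : Differentiable ℝ f) {L : ℝ}
    (h : ∀ t ∈ Set.Icc 0 L, f t = 0 → deriv f t ≠ 0) :
    {t | t ∈ Set.Icc 0 L ∧ f t = 0}.Finite := by
  have hK : IsCompact {t | t ∈ Set.Icc 0 L ∧ f t = 0} :=
    isCompact_Icc.inter_right (isClosed_eq hf.continuous continuous_const)
  refine hK.finite (isDiscrete_iff_nhdsNE.2 fun z hz => ?_)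
  have h1 := (hf z).hasDerivAt.eventually_ne (c := 0) (h z hz.1 hz.2)
  rw [inf_principal_eq_bot]
  filter_upwards [h1] with t ht hts using ht hts.2

/-- The number of sign changes of `f` along the regular partition of `[0, L]` into `n` parts. -/
def signChanges (f : ℝ → ℝ) (L : ℝ) (n : ℕ) : ℕ :=
  ((Finset.range n).filter fun i : ℕ => f (i * (L / n)) * f ((i + 1) * (L / n)) < 0).card

lemma signChanges_le_ncard {f : ℝ → ℝ} (hf : Continuous f) {L : ℝ} (hL : 0 < L)
    (hfin : {t | t ∈ Set.Icc 0 L ∧ f t = 0}.Finite) (n : ℕ) :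
    signChanges f L n ≤ {t | t ∈ Set.Icc 0 L ∧ f t = 0}.ncard := by
  have key : ∀ i : ℕ, ∃ z : ℝ, i < n ∧ f (i * (L / n)) * f ((i + 1) * (L / n)) < 0 →
      i * (L / n) < z ∧ z < (i + 1) * (L / n) ∧ f z = 0 := by
    intro i
    by_cases hi : i < n ∧ f (i * (L / n)) * f ((i + 1) * (L / n)) < 0
    · have hn : (0 : ℝ) < n := by exact_mod_cast (Nat.zero_le i).trans_lt hi.1
      have hle : i * (L / n) ≤ (i + 1) * (L / n) := by gcongr; linarith
      have h0 : (0 : ℝ) ∈ Set.uIcc (f (i * (L / n))) (f ((i + 1) * (L / n))) := by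
        rw [Set.mem_uIcc]
        rcases mul_neg_iff.1 hi.2 with h | h
        · exact Or.inr ⟨h.2.le, h.1.le⟩
        · exact Or.inl ⟨h.1.le, h.2.le⟩
      obtain ⟨z, hz, hz0⟩ := intermediate_value_uIcc hf.continuousOn h0
      rw [Set.uIcc_of_le hle] at hz
      refine ⟨z, fun _ => ⟨lt_of_le_of_ne hz.1 ?_, lt_of_le_of_ne hz.2 ?_, hz0⟩⟩
      · rintro h; rw [h, hz0] at hi; simp at hi
      · rintro h; rw [← h, hz0] at hi; simp at hi
    · exact ⟨0, fun h => absurd h hi⟩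
  choose g hg using key
  rw [signChanges, ← Set.ncard_coe_finset]
  refine Set.ncard_le_ncard_of_injOn g ?_ ?_ hfin
  · intro i hi
    simp only [Finset.coe_filter, Finset.mem_range, Set.mem_ofPred_eq] at hi
    obtain ⟨h1, h2, h3⟩ := hg i hi
    have hn : (0 : ℝ) < n := by exact_mod_cast (Nat.zero_le i).trans_lt hi.1
    refine ⟨⟨?_, ?_⟩, h3⟩
    · exact le_trans (by positivity) h1.le
    · have : ((i : ℝ) + 1) * (L / n) ≤ n * (L / n) := by
        gcongr; exact_mod_cast hi.1
      rw [mul_div_cancel₀ _ hn.ne'] at this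
      linarith
  · intro i hi j hj hij
    simp only [Finset.coe_filter, Finset.mem_range, Set.mem_ofPred_eq] at hi hj
    have hn : (0 : ℝ) < n := by exact_mod_cast (Nat.zero_le i).trans_lt hi.1
    have hh : 0 < L / n := by positivity
    obtain ⟨h1, h2, -⟩ := hg i hi
    obtain ⟨h1', h2', -⟩ := hg j hj
    have h3 : (i : ℝ) < j + 1 := lt_of_mul_lt_mul_right (by linarith) hh.le
    have h4 : (j : ℝ) < i + 1 := lt_of_mul_lt_mul_right (by linarith) hh.le
    norm_cast at h3 h4
    omega

lemma tendsto_div_natCast_nhdsGT {L : ℝ} (hL : 0 < L) :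
    Tendsto (fun n : ℕ => L / n) atTop (𝓝[>] 0) := by
  refine tendsto_nhdsWithin_iff.2 ⟨tendsto_const_div_atTop_nhds_zero_nat L, ?_⟩
  filter_upwards [eventually_gt_atTop 0] with n hn
  exact div_pos hL (by exact_mod_cast hn)

lemma eventually_ncard_le_signChanges {f : ℝ → ℝ} (hf : Differentiable ℝ f) {L : ℝ} (hL : 0 < L)
    (hfin : {t | t ∈ Set.Icc 0 L ∧ f t = 0}.Finite)
    (hd : ∀ t ∈ Set.Icc 0 L, f t = 0 → deriv f t ≠ 0)
    (hne : ∀ n i : ℕ, f (i * (L / n)) ≠ 0) :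
    ∀ᶠ n in atTop, {t | t ∈ Set.Icc 0 L ∧ f t = 0}.ncard ≤ signChanges f L n := by
  have h1 : ∀ᶠ h in 𝓝[>] (0 : ℝ), ∀ z ∈ {t | t ∈ Set.Icc 0 L ∧ f t = 0},
      ∀ a b, z - h < a → a < z → z < b → b < z + h → f a * f b < 0 :=
    (hfin.eventually_all).2 fun z hz =>
      (hf z).hasDerivAt.eventually_mul_neg_of_eq_zero hz.2 (hd z hz.1 hz.2)
  have h2 : ∀ᶠ h in 𝓝[>] (0 : ℝ), ∀ z ∈ {t | t ∈ Set.Icc 0 L ∧ f t = 0},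
      ∀ w ∈ {t | t ∈ Set.Icc 0 L ∧ f t = 0}, z ≠ w → h < |z - w| := by
    refine (hfin.eventually_all).2 fun z _ => (hfin.eventually_all).2 fun w _ => ?_
    by_cases hzw : z = w
    · simp [hzw]
    · filter_upwards [Ioo_mem_nhdsGT (abs_pos.2 (sub_ne_zero.2 hzw))] with h hh _ using hh.2
  filter_upwards [eventually_gt_atTop 0, (tendsto_div_natCast_nhdsGT hL).eventually h1,
    (tendsto_div_natCast_nhdsGT hL).eventually h2] with n hn h1 h2
  have hn' : (0 : ℝ) < n := by exact_mod_cast hn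
  have hh : 0 < L / n := by positivity
  have hfl : ∀ z ∈ {t | t ∈ Set.Icc 0 L ∧ f t = 0},
      ⌊z / (L / n)⌋₊ * (L / n) < z ∧ z < (⌊z / (L / n)⌋₊ + 1) * (L / n) := by
    intro z hz
    constructor
    · refine lt_of_le_of_ne ?_ ?_
      · rw [← le_div_iff₀ hh]
        exact Nat.floor_le (div_nonneg hz.1.1 hh.le)
      · intro h
        exact hne n ⌊z / (L / n)⌋₊ (by rw [h]; exact hz.2)
    · rw [← div_lt_iff₀ hh]
      exact Nat.lt_floor_add_one _
  rw [signChanges, ← Set.ncard_coe_finset]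
  refine Set.ncard_le_ncard_of_injOn (fun z => ⌊z / (L / n)⌋₊) ?_ ?_ (Finset.finite_toSet _)
  · intro z hz
    obtain ⟨h3, h4⟩ := hfl z hz
    simp only [Finset.coe_filter, Finset.mem_range, Set.mem_ofPred_eq]
    constructor
    · have h5 : (⌊z / (L / n)⌋₊ : ℝ) * (L / n) < n * (L / n) := by
        rw [mul_div_cancel₀ _ hn'.ne']
        exact h3.trans_le hz.1.2
      exact_mod_cast lt_of_mul_lt_mul_right h5 hh.le
    · exact h1 z hz _ _ (by linarith) h3 h4 (by linarith)
  · intro z hz w hw hzw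
    obtain ⟨h3, h4⟩ := hfl z hz
    obtain ⟨h3', h4'⟩ := hfl w hw
    simp only at hzw
    rw [← hzw] at h3' h4'
    by_contra hne
    refine absurd (h2 z hz w hw hne) (not_lt.2 ?_)
    rw [abs_le]
    constructor <;> linarith

lemma exists_taylor_bound {H : Type*} [NormedAddCommGroup H] [NormedSpace ℝ H] {v : ℝ → H}
    (hv : ContDiff ℝ 2 v) (L : ℝ) :
    ∃ M : ℝ, 0 ≤ M ∧ ∀ s ∈ Set.Icc 0 L, ∀ t ∈ Set.Icc 0 L,
      ‖deriv v s - deriv v t‖ ≤ M * |s - t| ∧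
      ‖v s - v t - (s - t) • deriv v t‖ ≤ M * |s - t| ^ 2 := by
  have hv1 : ContDiff ℝ 1 (deriv v) := (contDiff_succ_iff_deriv.1 hv).2.2
  have hd : Differentiable ℝ v := hv.differentiable (by norm_num)
  have hd1 : Differentiable ℝ (deriv v) := hv1.differentiable (by norm_num)
  obtain ⟨M, hM⟩ := isCompact_Icc.exists_bound_of_continuousOn (s := Set.Icc 0 L)
    (f := deriv (deriv v)) (hv1.continuous_deriv le_rfl).continuousOn
  have hlip : ∀ s ∈ Set.Icc 0 L, ∀ t ∈ Set.Icc 0 L,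
      ‖deriv v s - deriv v t‖ ≤ max M 0 * |s - t| := by
    intro s hs t ht
    exact (convex_Icc 0 L).norm_image_sub_le_of_norm_deriv_le (fun x _ => hd1 x)
      (fun x hx => (hM x hx).trans (le_max_left _ _)) ht hs
  refine ⟨max M 0, le_max_right _ _, fun s hs t ht => ⟨hlip s hs t ht, ?_⟩⟩
  have hsub : Set.uIcc t s ⊆ Set.Icc 0 L := Set.ordConnected_Icc.uIcc_subset ht hs
  have h := (convex_uIcc t s).norm_image_sub_le_of_norm_hasDerivWithin_le
    (f := fun x => v x - (x - t) • deriv v t) (f' := fun x => deriv v x - deriv v t)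
    (C := max M 0 * |s - t|)
    (fun x _ => by
      have := (hd x).hasDerivAt.sub (((hasDerivAt_id x).sub_const t).smul_const (deriv v t))
      rw [one_smul] at this
      exact this.hasDerivWithinAt)
    (fun x hx => (hlip x (hsub hx) t ht).trans
      (mul_le_mul_of_nonneg_left (Set.abs_sub_left_of_mem_uIcc hx) (le_max_right _ _)))
    Set.left_mem_uIcc Set.right_mem_uIcc
  simp only [sub_self, zero_smul, sub_zero] at h
  rw [norm_eq_abs] at h
  calc _ = ‖v s - (s - t) • deriv v t - v t‖ := by congr 1; abel
    _ ≤ _ := h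
    _ = _ := by ring

lemma inner_deriv_eq_zero_of_norm_eq_one {H : Type*} [NormedAddCommGroup H]
    [InnerProductSpace ℝ H] {v : ℝ → H} (hd : Differentiable ℝ v) (hv : ∀ t, ‖v t‖ = 1) (t : ℝ) :
    inner ℝ (v t) (deriv v t) = 0 := by
  have h1 := (hd t).hasDerivAt.inner ℝ (hd t).hasDerivAt
  have h2 : (fun t => inner ℝ (v t) (v t)) = fun _ => (1 : ℝ) := by
    ext t; rw [real_inner_self_eq_norm_sq, hv, one_pow]
  have h3 := h1.unique (h2 ▸ hasDerivAt_const t (1 : ℝ))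
  rw [real_inner_comm (v t) (deriv v t)] at h3
  linarith

lemma exists_grid_point {L : ℝ} (hL : 0 < L) {n : ℕ} (hn : 0 < n) {t : ℝ} (ht : t ∈ Set.Icc 0 L) :
    ∃ i ∈ Finset.range (n + 1), (i * (L / n) : ℝ) ∈ Set.Icc 0 L ∧ |i * (L / n) - t| ≤ L / n := by
  have hn' : (0 : ℝ) < n := by exact_mod_cast hn
  have hh : 0 < L / n := by positivity
  have h1 : (⌊t / (L / n)⌋₊ : ℝ) * (L / n) ≤ t := by
    rw [← le_div_iff₀ hh]
    exact Nat.floor_le (div_nonneg ht.1 hh.le)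
  have h2 : t < (⌊t / (L / n)⌋₊ + 1) * (L / n) := by
    rw [← div_lt_iff₀ hh]
    exact Nat.lt_floor_add_one _
  refine ⟨⌊t / (L / n)⌋₊, ?_, ⟨by positivity, h1.trans ht.2⟩, ?_⟩
  · rw [Finset.mem_range, Nat.lt_succ_iff]
    have h3 : (⌊t / (L / n)⌋₊ : ℝ) * (L / n) ≤ n * (L / n) := by
      rw [mul_div_cancel₀ _ hn'.ne']
      exact h1.trans ht.2
    exact_mod_cast le_of_mul_le_mul_right h3 hh
  · rw [abs_le]
    constructor <;> linarith

lemma isLittleO_arcsin : (fun x => arcsin x - x) =o[𝓝 0] (fun x => x) := by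
  have := (hasDerivAt_arcsin (x := 0) (by norm_num) (by norm_num)).isLittleO
  simpa using this

section GaussianCurve

variable {H : Type*} [NormedAddCommGroup H] [InnerProductSpace ℝ H]

lemma eventually_abs_arcsin_sub_le {v : ℝ → H} (hv2 : ContDiff ℝ 2 v)
    {c L : ℝ} (hc : 0 < c) (hv' : ∀ t ∈ Set.Icc 0 L, ‖deriv v t‖ = c)
    {ε : ℝ} (hε : 0 < ε) :
    ∀ᶠ h in 𝓝[>] (0 : ℝ), ∀ t, t ∈ Set.Icc 0 L → t + h ∈ Set.Icc 0 L →
      |2 * arcsin (‖v t - v (t + h)‖ / 2) - c * h| ≤ ε * h := by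
  obtain ⟨M, hM0, hM⟩ := exists_taylor_bound hv2 L
  have h1 := isLittleO_arcsin.def (c := ε / (2 * (c + M))) (by positivity)
  rw [Metric.eventually_nhds_iff] at h1
  obtain ⟨δ, hδ, h1⟩ := h1
  filter_upwards [Ioo_mem_nhdsGT one_pos,
    Ioo_mem_nhdsGT (show 0 < δ / (c + M) by positivity),
    Ioo_mem_nhdsGT (show 0 < ε / (2 * (M + 1)) by positivity)] with h ha hb hb' t ht hth
  obtain ⟨hh, ha⟩ := ha
  have hb := hb.2
  have hb' := hb'.2
  rw [lt_div_iff₀ (by positivity)] at hb hb'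
  have h2 := (hM _ hth _ ht).2
  rw [add_sub_cancel_left, abs_of_pos hh] at h2
  have h3 : |‖v t - v (t + h)‖ - c * h| ≤ M * h ^ 2 := by
    have h4 := abs_norm_sub_norm_le (v (t + h) - v t) (h • deriv v t)
    rw [norm_smul, hv' t ht, norm_eq_abs, abs_of_pos hh, norm_sub_rev, mul_comm h] at h4
    exact h4.trans h2
  set d := ‖v t - v (t + h)‖
  have hd0 : 0 ≤ d := norm_nonneg _
  have h5 : d ≤ (c + M) * h := by
    have h4 : M * h ^ 2 ≤ M * h := by
      rw [sq]
      exact mul_le_mul_of_nonneg_left (mul_le_of_le_one_left hh.le ha.le) hM0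
    linarith [(abs_le.1 h3).2, add_mul c M h]
  have h6 := h1 (y := d / 2) (by
    rw [dist_zero_right, norm_eq_abs, abs_of_nonneg (by positivity)]
    nlinarith)
  rw [norm_eq_abs, norm_eq_abs, abs_of_nonneg (by positivity : 0 ≤ d / 2)] at h6
  have h7 : ε / (2 * (c + M)) * (d / 2) ≤ ε / 4 * h := by
    calc _ ≤ ε / (2 * (c + M)) * ((c + M) * h / 2) := by gcongr
      _ = _ := by field_simp; norm_num
  have h8 : M * h ^ 2 ≤ ε / 2 * h := by nlinarith
  rw [abs_le] at *
  constructor <;> nlinarith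

lemma tendsto_sum_arcsin {v : ℝ → H} (hv2 : ContDiff ℝ 2 v)
    {c L : ℝ} (hc : 0 < c) (hL : 0 < L) (hv' : ∀ t ∈ Set.Icc 0 L, ‖deriv v t‖ = c) :
    Tendsto (fun n : ℕ => ∑ i ∈ Finset.range n,
      2 * arcsin (‖v (i * (L / n)) - v ((i + 1) * (L / n))‖ / 2) / π) atTop (𝓝 (c * L / π)) := by
  simp_rw [← Finset.sum_div]
  refine Tendsto.div_const ?_ _
  rw [Metric.tendsto_nhds]
  intro ε hε
  filter_upwards [eventually_gt_atTop 0, (tendsto_div_natCast_nhdsGT hL).eventually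
    (eventually_abs_arcsin_sub_le hv2 hc hv' (ε := ε / (2 * L)) (by positivity))] with n hn h1
  have hn' : (0 : ℝ) < n := by exact_mod_cast hn
  have hh : 0 < L / n := by positivity
  have h2 : c * L = ∑ i ∈ Finset.range n, c * (L / n) := by
    rw [Finset.sum_const, Finset.card_range, nsmul_eq_mul]; field_simp
  rw [Real.dist_eq, h2, ← Finset.sum_sub_distrib]
  calc _ ≤ ∑ i ∈ Finset.range n, |_| := Finset.abs_sum_le_sum_abs _ _
    _ ≤ ∑ i ∈ Finset.range n, ε / (2 * L) * (L / n) := by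
      refine Finset.sum_le_sum fun i hi => ?_
      have hi' : (i : ℝ) + 1 ≤ n := by exact_mod_cast Finset.mem_range.1 hi
      have h3 : ((i : ℝ) + 1) * (L / n) ≤ L := by
        calc _ ≤ n * (L / n) := by gcongr
          _ = L := mul_div_cancel₀ _ hn'.ne'
      rw [add_mul, one_mul] at h3 ⊢
      exact h1 _ ⟨by positivity, by linarith⟩ ⟨by positivity, h3⟩
    _ = ε / 2 := by
      rw [Finset.sum_const, Finset.card_range, nsmul_eq_mul]; field_simp
    _ < ε := half_lt_self hε

lemma eventually_inner_nonneg {v : ℝ → H} (hc : Continuous v) (hv : ∀ t, ‖v t‖ = 1) {L : ℝ}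
    (hL : 0 < L) :
    ∀ᶠ n : ℕ in atTop, ∀ i < n, 0 ≤ inner ℝ (v (i * (L / n))) (v ((i + 1) * (L / n))) := by
  have huc := isCompact_Icc.uniformContinuousOn_of_continuous (s := Set.Icc 0 L) hc.continuousOn
  rw [Metric.uniformContinuousOn_iff] at huc
  obtain ⟨δ, hδ, h⟩ := huc 1 one_pos
  filter_upwards [eventually_gt_atTop 0,
    (tendsto_div_natCast_nhdsGT hL).eventually (Ioo_mem_nhdsGT hδ)] with n hn h1 i hi
  have hn' : (0 : ℝ) < n := by exact_mod_cast hn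
  obtain ⟨hh, h1⟩ := h1
  have hi' : (i : ℝ) + 1 ≤ n := by exact_mod_cast hi
  have h3 : ((i : ℝ) + 1) * (L / n) ≤ L := by
    calc _ ≤ n * (L / n) := by gcongr
      _ = L := mul_div_cancel₀ _ hn'.ne'
  have h4 := h (i * (L / n)) ⟨by positivity, by linarith⟩ ((i + 1) * (L / n))
    ⟨by positivity, h3⟩ (by
      rw [Real.dist_eq, add_mul, one_mul, sub_add_cancel_left, abs_neg, abs_of_pos hh]
      exact h1)
  rw [dist_eq_norm] at h4
  have h5 := norm_sub_sq_real (v (i * (L / n))) (v ((i + 1) * (L / n)))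
  rw [hv, hv] at h5
  nlinarith [norm_nonneg (v (i * (L / n)) - v ((i + 1) * (L / n)))]

variable [FiniteDimensional ℝ H] [MeasurableSpace H] [BorelSpace H]

/-- Bulinskaya's lemma: almost surely, all zeros of the process are simple. -/
lemma ae_inner_deriv_ne_zero {v : ℝ → H} (hv2 : ContDiff ℝ 2 v) (hv : ∀ t, ‖v t‖ = 1)
    {c L : ℝ} (hc : 0 < c) (hL : 0 < L) (hv' : ∀ t ∈ Set.Icc 0 L, ‖deriv v t‖ = c) :
    ∀ᵐ x ∂stdGaussian H, ∀ t ∈ Set.Icc 0 L, inner ℝ (v t) x = 0 → inner ℝ (deriv v t) x ≠ 0 := by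
  obtain ⟨M, hM0, hM⟩ := exists_taylor_bound hv2 L
  have hd : Differentiable ℝ v := hv2.differentiable (by norm_num)
  set B : Set H := {x | ∃ t ∈ Set.Icc 0 L, inner ℝ (v t) x = 0 ∧ inner ℝ (deriv v t) x = 0}
  suffices hR : ∀ R : ℕ, stdGaussian H (B ∩ {x | ‖x‖ ≤ R}) = 0 by
    have h1 : stdGaussian H (⋃ R : ℕ, B ∩ {x | ‖x‖ ≤ R}) = 0 := measure_iUnion_null hR
    rw [← Set.inter_iUnion] at h1
    have h2 : (⋃ R : ℕ, {x : H | ‖x‖ ≤ R}) = Set.univ := by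
      ext x
      simpa using exists_nat_ge ‖x‖
    rw [h2, Set.inter_univ] at h1
    rw [ae_iff]
    refine measure_mono_null (fun x hx => ?_) h1
    simp only [Set.mem_ofPred_eq] at hx
    push Not at hx
    exact hx
  intro R
  have hbound : ∀ n : ℕ, 0 < n → stdGaussian H (B ∩ {x | ‖x‖ ≤ R}) ≤
      ENNReal.ofReal ((n + 1) * (4 * (R * M * (L / n) ^ 2) * (R * M * (L / n) / c))) := by
    intro n hn
    set h := L / n with hh
    have hh0 : 0 < h := div_pos hL (by exact_mod_cast hn)
    let I := (Finset.range (n + 1)).filter fun i : ℕ => (i * h : ℝ) ∈ Set.Icc 0 L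
    have hsub : B ∩ {x | ‖x‖ ≤ R} ⊆ ⋃ i ∈ I,
        {x | |inner ℝ (v (i * h)) x| ≤ R * M * h ^ 2 ∧
          |inner ℝ (c⁻¹ • deriv v (i * h)) x| ≤ R * M * h / c} := by
      rintro x ⟨⟨t, ht, h0, h0'⟩, hx⟩
      obtain ⟨i, hi, hit, hi2⟩ := exists_grid_point hL hn ht
      rw [← hh] at hit hi2
      obtain ⟨hT1, hT2⟩ := hM _ hit t ht
      have hx : ‖x‖ ≤ R := hx
      refine Set.mem_biUnion (x := i) (by simpa [I] using ⟨by simpa using hi, hit⟩) ⟨?_, ?_⟩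
      · have h3 : inner ℝ (v (i * h)) x =
            inner ℝ (v (i * h) - v t - (i * h - t) • deriv v t) x := by
          rw [inner_sub_left, inner_sub_left, real_inner_smul_left, h0, h0']; ring
        rw [h3]
        calc _ ≤ ‖v (i * h) - v t - (i * h - t) • deriv v t‖ * ‖x‖ := abs_real_inner_le_norm _ _
          _ ≤ (M * h ^ 2) * R := by
            gcongr
            exact hT2.trans (by gcongr)
          _ = _ := by ring
      · have h3 : inner ℝ (deriv v (i * h)) x = inner ℝ (deriv v (i * h) - deriv v t) x := by
          rw [inner_sub_left, h0', sub_zero]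
        rw [real_inner_smul_left, h3, abs_mul, abs_inv, abs_of_pos hc, inv_mul_eq_div]
        gcongr
        calc _ ≤ ‖deriv v (i * h) - deriv v t‖ * ‖x‖ := abs_real_inner_le_norm _ _
          _ ≤ (M * h) * R := by
            gcongr
            exact hT1.trans (by gcongr)
          _ = _ := by ring
    calc _ ≤ _ := measure_mono hsub
      _ ≤ ∑ i ∈ I, _ := measure_biUnion_finset_le _ _
      _ ≤ ∑ i ∈ I, ENNReal.ofReal (4 * (R * M * h ^ 2) * (R * M * h / c)) := by
        refine Finset.sum_le_sum fun i hi => stdGaussian_abs_inner_le (hv _) ?_ ?_ (by positivity)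
        · rw [norm_smul, hv' _ (Finset.mem_filter.1 hi).2, norm_inv, norm_eq_abs, abs_of_pos hc,
            inv_mul_cancel₀ hc.ne']
        · rw [real_inner_smul_right, inner_deriv_eq_zero_of_norm_eq_one hd hv, mul_zero]
      _ ≤ ∑ i ∈ Finset.range (n + 1), ENNReal.ofReal (4 * (R * M * h ^ 2) * (R * M * h / c)) :=
        Finset.sum_le_sum_of_subset (Finset.filter_subset _ _)
      _ = _ := by
        rw [Finset.sum_const, Finset.card_range, nsmul_eq_mul,
          ENNReal.ofReal_mul (p := (n : ℝ) + 1) (by positivity)]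
        congr 1
        rw [← Nat.cast_add_one, ENNReal.ofReal_natCast]
  have hlim : Tendsto (fun n : ℕ =>
      ENNReal.ofReal ((n + 1) * (4 * (R * M * (L / n) ^ 2) * (R * M * (L / n) / c))))
      atTop (𝓝 0) := by
    rw [← ENNReal.ofReal_zero]
    refine ENNReal.tendsto_ofReal ?_
    have h0 := tendsto_const_div_atTop_nhds_zero_nat L
    have h1 : Tendsto (fun n : ℕ => (L + L / n) * (4 * (R * M * (L / n)) * (R * M * (L / n) / c)))
        atTop (𝓝 ((L + 0) * (4 * (R * M * 0) * (R * M * 0 / c)))) :=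
      (h0.const_add L).mul (((h0.const_mul _).const_mul _).mul ((h0.const_mul _).div_const _))
    simp only [mul_zero, zero_div] at h1
    refine h1.congr' ?_
    filter_upwards [eventually_gt_atTop 0] with n hn
    have hn' : (n : ℝ) ≠ 0 := by exact_mod_cast hn.ne'
    field_simp
  refine le_antisymm (ge_of_tendsto hlim ?_) zero_le
  filter_upwards [eventually_gt_atTop 0] with n hn using hbound n hn

lemma lintegral_signChanges {v : ℝ → H} (hv : ∀ t, ‖v t‖ = 1) {L : ℝ} {n : ℕ}
    (hn : ∀ i < n, 0 ≤ inner ℝ (v (i * (L / n))) (v ((i + 1) * (L / n)))) :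
    ∫⁻ x, (signChanges (fun t => inner ℝ (v t) x) L n : ENNReal) ∂stdGaussian H =
      ENNReal.ofReal (∑ i ∈ Finset.range n,
        2 * arcsin (‖v (i * (L / n)) - v ((i + 1) * (L / n))‖ / 2) / π) := by
  have hA (i : ℕ) : MeasurableSet {x : H | inner ℝ (v (i * (L / n))) x *
      inner ℝ (v ((i + 1) * (L / n))) x < 0} :=
    measurableSet_lt (by fun_prop) (by fun_prop)
  have h1 (x : H) : (signChanges (fun t => inner ℝ (v t) x) L n : ENNReal) =
      ∑ i ∈ Finset.range n, Set.indicator {x : H | inner ℝ (v (i * (L / n))) x *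
        inner ℝ (v ((i + 1) * (L / n))) x < 0} 1 x := by
    simp [signChanges, Set.indicator_apply]
  simp_rw [h1]
  rw [lintegral_finsetSum _ fun i _ => measurable_one.indicator (hA i),
    ENNReal.ofReal_sum_of_nonneg]
  · refine Finset.sum_congr rfl fun i hi => ?_
    rw [lintegral_indicator_one (hA i),
      stdGaussian_sign_change (hv _) (hv _) (hn i (Finset.mem_range.1 hi))]
  · intro i _
    have : 0 ≤ arcsin (‖v (i * (L / n)) - v ((i + 1) * (L / n))‖ / 2) :=
      arcsin_nonneg.2 (by positivity)
    positivity

/-- The Kac–Rice (Crofton) formula for the expected number of hyperplane crossings of a spherical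
curve of constant speed `c`, the hyperplane having a standard Gaussian normal vector. -/
lemma integral_ncard_zeros {v : ℝ → H} (hv2 : ContDiff ℝ 2 v) (hv : ∀ t, ‖v t‖ = 1)
    {c L : ℝ} (hc : 0 < c) (hL : 0 < L) (hv' : ∀ t ∈ Set.Icc 0 L, ‖deriv v t‖ = c) :
    AEStronglyMeasurable (fun x => ({t | t ∈ Set.Icc 0 L ∧ inner ℝ (v t) x = 0}.ncard : ℝ))
      (stdGaussian H) ∧
    ∫ x, ({t | t ∈ Set.Icc 0 L ∧ inner ℝ (v t) x = 0}.ncard : ℝ) ∂stdGaussian H =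
      c * L / π := by
  have hd : Differentiable ℝ v := hv2.differentiable (by norm_num)
  set Z : H → ℕ := fun x => {t | t ∈ Set.Icc 0 L ∧ inner ℝ (v t) x = 0}.ncard with hZ
  set S : ℕ → H → ℕ := fun n x => signChanges (fun t => inner ℝ (v t) x) L n with hS
  have hderiv (x : H) (t : ℝ) :
      HasDerivAt (fun t => inner ℝ (v t) x) (inner ℝ (deriv v t) x) t := by
    simpa using (hd t).hasDerivAt.inner ℝ (hasDerivAt_const t x)
  have hgrid : ∀ᵐ x ∂stdGaussian H, ∀ n i : ℕ, inner ℝ (v (i * (L / n))) x ≠ 0 := by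
    refine ae_all_iff.2 fun n => ae_all_iff.2 fun i => ?_
    rw [ae_iff]
    simpa using stdGaussian_inner_eq_zero (hv (i * (L / n)))
  have hmain : ∀ᵐ x ∂stdGaussian H, (∀ n, S n x ≤ Z x) ∧ ∀ᶠ n in atTop, S n x = Z x := by
    filter_upwards [hgrid, ae_inner_deriv_ne_zero hv2 hv hc hL hv'] with x h1 h2
    have hdf : Differentiable ℝ fun t => inner ℝ (v t) x :=
      fun t => (hderiv x t).differentiableAt
    have h3 : ∀ t ∈ Set.Icc 0 L, inner ℝ (v t) x = 0 → deriv (fun t => inner ℝ (v t) x) t ≠ 0 := by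
      intro t ht h0
      rw [(hderiv x t).deriv]
      exact h2 t ht h0
    have hfin := finite_zeros_of_deriv_ne_zero hdf h3
    have h4 : ∀ n, S n x ≤ Z x := fun n => signChanges_le_ncard hdf.continuous hL hfin n
    refine ⟨h4, ?_⟩
    filter_upwards [eventually_ncard_le_signChanges hdf hL hfin h3 h1] with n hn
    exact le_antisymm (h4 n) hn
  have hSm (n : ℕ) : Measurable (S n) := by
    simp only [hS, signChanges, Finset.card_filter]
    refine Finset.measurable_sum _ fun i _ => Measurable.ite ?_ measurable_const measurable_const
    exact measurableSet_lt (by fun_prop) (by fun_prop)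
  have hZm : AEStronglyMeasurable (fun x => (Z x : ℝ)) (stdGaussian H) := by
    refine aestronglyMeasurable_of_tendsto_ae atTop (f := fun n x => (S n x : ℝ))
      (fun n => (measurable_from_nat.comp (hSm n)).aestronglyMeasurable) ?_
    filter_upwards [hmain] with x hx
    refine tendsto_const_nhds.congr' ?_
    filter_upwards [hx.2] with n hn
    rw [hn]
  refine ⟨hZm, ?_⟩
  have hlim : Tendsto (fun n => ∫⁻ x, (S n x : ENNReal) ∂stdGaussian H) atTop
      (𝓝 (ENNReal.ofReal (c * L / π))) := by
    refine (ENNReal.tendsto_ofReal (tendsto_sum_arcsin hv2 hc hL hv')).congr' ?_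
    filter_upwards [eventually_inner_nonneg hd.continuous hv hL] with n hn
    exact (lintegral_signChanges hv hn).symm
  have hle : ∫⁻ x, (Z x : ENNReal) ∂stdGaussian H ≤ ENNReal.ofReal (c * L / π) := by
    rw [← hlim.liminf_eq]
    refine le_trans (lintegral_mono_ae ?_)
      (lintegral_liminf_le fun n => measurable_from_nat.comp (hSm n))
    filter_upwards [hmain] with x hx
    refine (Tendsto.liminf_eq (tendsto_const_nhds.congr' ?_)).ge
    filter_upwards [hx.2] with n hn
    simp [hn]
  have hge : ENNReal.ofReal (c * L / π) ≤ ∫⁻ x, (Z x : ENNReal) ∂stdGaussian H := by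
    refine le_of_tendsto hlim (Eventually.of_forall fun n => lintegral_mono_ae ?_)
    filter_upwards [hmain] with x hx
    exact_mod_cast hx.1 n
  rw [integral_eq_lintegral_of_nonneg_ae (Eventually.of_forall fun x => Nat.cast_nonneg _) hZm]
  simp_rw [ENNReal.ofReal_natCast]
  rw [le_antisymm hle hge, ENNReal.toReal_ofReal (by positivity)]

end GaussianCurve

lemma mem_latticeSet {m : ℕ} {μ : ℤ × ℤ} :
    μ ∈ latticeSet m ↔ μ.1 ^ 2 + μ.2 ^ 2 = (m : ℤ) := by
  simp only [latticeSet, Finset.mem_filter, Finset.mem_product, Finset.mem_Icc,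
    and_iff_right_iff_imp]
  intro h
  rw [← abs_le, ← abs_le]
  constructor
  · have := Int.le_self_sq |μ.1|
    rw [sq_abs] at this
    nlinarith [sq_nonneg μ.2]
  · have := Int.le_self_sq |μ.2|
    rw [sq_abs] at this
    nlinarith [sq_nonneg μ.1]

lemma sum_latticeSet_sq (m : ℕ) (a b : ℝ) :
    ∑ μ : ↥(latticeSet m), ((μ : ℤ × ℤ).1 * a + (μ : ℤ × ℤ).2 * b) ^ 2 =
      latN m * m * (a ^ 2 + b ^ 2) / 2 := by
  rw [Finset.sum_coe_sort (latticeSet m) fun μ : ℤ × ℤ => ((μ.1 : ℝ) * a + μ.2 * b) ^ 2]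
  have hrot : ∑ μ ∈ latticeSet m, ((μ.1 : ℝ) * a + μ.2 * b) ^ 2 =
      ∑ μ ∈ latticeSet m, ((μ.2 : ℝ) * a - μ.1 * b) ^ 2 := by
    refine Finset.sum_nbij' (fun μ => (-μ.2, μ.1)) (fun μ => (μ.2, -μ.1)) ?_ ?_ ?_ ?_ ?_
    · intro μ hμ
      rw [mem_latticeSet] at hμ ⊢
      rw [← hμ]; ring
    · intro μ hμ
      rw [mem_latticeSet] at hμ ⊢
      rw [← hμ]; ring
    · simp
    · simp
    · intro μ _
      push_cast
      ring
  have hsum : ∑ μ ∈ latticeSet m, ((μ.1 : ℝ) * a + μ.2 * b) ^ 2 +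
      ∑ μ ∈ latticeSet m, ((μ.2 : ℝ) * a - μ.1 * b) ^ 2 = latN m * (m * (a ^ 2 + b ^ 2)) := by
    rw [← Finset.sum_add_distrib, latN, ← nsmul_eq_mul, ← Finset.sum_const]
    refine Finset.sum_congr rfl fun μ hμ => ?_
    have : (μ.1 : ℝ) ^ 2 + (μ.2 : ℝ) ^ 2 = m := by exact_mod_cast mem_latticeSet.1 hμ
    rw [← this]; ring
  linarith

/-- The Gaussian coefficients of the wave as a vector of a Euclidean space. -/
def coeffVec (m : ℕ) (ω : WaveSpace m) :
    EuclideanSpace ℝ (↥(latticeSet m) ⊕ ↥(latticeSet m)) :=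
  WithLp.toLp 2 (Sum.elim ω.1 ω.2)

lemma measurePreserving_coeffVec (m : ℕ) :
    MeasurePreserving (coeffVec m) (waveMeasure m) (stdGaussian _) := by
  have h1 := measurePreserving_sumPiEquivProdPi_symm
    (fun _ : ↥(latticeSet m) ⊕ ↥(latticeSet m) => gaussianReal 0 1)
  have h2 : MeasurePreserving (WithLp.toLp 2)
      (Measure.pi fun _ : ↥(latticeSet m) ⊕ ↥(latticeSet m) => gaussianReal 0 1)
      (stdGaussian (EuclideanSpace ℝ (↥(latticeSet m) ⊕ ↥(latticeSet m)))) :=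
    ⟨by fun_prop, map_pi_eq_stdGaussian⟩
  convert! h2.comp h1 using 1

/-- The phase `2π⟨μ, γ(t)⟩` of the plane wave of frequency `μ` along the curve `γ`. -/
def phase (γ : ℝ → ℝ × ℝ) (μ : ℤ × ℤ) (t : ℝ) : ℝ :=
  2 * π * ((μ.1 : ℝ) * (γ t).1 + (μ.2 : ℝ) * (γ t).2)

/-- The spherical curve whose inner product with the coefficient vector is the wave along `γ`. -/
def waveCurve (m : ℕ) (γ : ℝ → ℝ × ℝ) (t : ℝ) :
    EuclideanSpace ℝ (↥(latticeSet m) ⊕ ↥(latticeSet m)) :=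
  WithLp.toLp 2 fun i => (√(latN m))⁻¹ *
    Sum.elim (fun μ : ↥(latticeSet m) => cos (phase γ μ t))
      (fun μ : ↥(latticeSet m) => sin (phase γ μ t)) i

lemma inner_waveCurve (m : ℕ) (γ : ℝ → ℝ × ℝ) (t : ℝ) (ω : WaveSpace m) :
    inner ℝ (waveCurve m γ t) (coeffVec m ω) = wave m ω (γ t) := by
  simp only [waveCurve, coeffVec, wave, phase, PiLp.inner_apply, Fintype.sum_sum_type,
    Sum.elim_inl, Sum.elim_inr, Finset.mul_sum, mul_add, Finset.sum_add_distrib, RCLike.inner_apply,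
    conj_trivial, mul_left_comm]

lemma norm_waveCurve {m : ℕ} (hN : 0 < latN m) (γ : ℝ → ℝ × ℝ) (t : ℝ) :
    ‖waveCurve m γ t‖ = 1 := by
  have hN' : (0 : ℝ) < latN m := by exact_mod_cast hN
  rw [← sq_eq_sq₀ (norm_nonneg _) zero_le_one, EuclideanSpace.real_norm_sq_eq]
  simp only [waveCurve, Fintype.sum_sum_type, Sum.elim_inl, Sum.elim_inr]
  rw [← Finset.sum_add_distrib]
  simp only [mul_pow, ← mul_add, cos_sq_add_sin_sq, inv_pow, sq_sqrt hN'.le]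
  rw [Finset.sum_const, Finset.card_univ, Fintype.card_coe, nsmul_eq_mul, one_pow, mul_one]
  exact mul_inv_cancel₀ hN'.ne'

lemma contDiff_phase {γ : ℝ → ℝ × ℝ} (hγ : ContDiff ℝ 2 γ) (μ : ℤ × ℤ) :
    ContDiff ℝ 2 (phase γ μ) := by
  unfold phase
  fun_prop

lemma contDiff_waveCurve (m : ℕ) {γ : ℝ → ℝ × ℝ} (hγ : ContDiff ℝ 2 γ) :
    ContDiff ℝ 2 (waveCurve m γ) := by
  rw [contDiff_piLp]
  rintro (μ | μ)
  · exact contDiff_const.mul (contDiff_phase hγ μ).cos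
  · exact contDiff_const.mul (contDiff_phase hγ μ).sin

lemma hasDerivAt_phase {γ : ℝ → ℝ × ℝ} {t : ℝ} (hγ : DifferentiableAt ℝ γ t) (μ : ℤ × ℤ) :
    HasDerivAt (phase γ μ) (2 * π * ((μ.1 : ℝ) * (deriv γ t).1 + (μ.2 : ℝ) * (deriv γ t).2)) t := by
  have h1 : HasDerivAt (fun s => (γ s).1) (deriv γ t).1 t :=
    ((ContinuousLinearMap.fst ℝ ℝ ℝ).hasFDerivAt (x := γ t)).comp_hasDerivAt t hγ.hasDerivAt
  have h2 : HasDerivAt (fun s => (γ s).2) (deriv γ t).2 t :=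
    ((ContinuousLinearMap.snd ℝ ℝ ℝ).hasFDerivAt (x := γ t)).comp_hasDerivAt t hγ.hasDerivAt
  exact ((h1.const_mul _).add (h2.const_mul _)).const_mul _

lemma norm_deriv_waveCurve {m : ℕ} (hN : 0 < latN m) {γ : ℝ → ℝ × ℝ} (hγ : Differentiable ℝ γ)
    {t : ℝ} (ht : (deriv γ t).1 ^ 2 + (deriv γ t).2 ^ 2 = 1) :
    ‖deriv (waveCurve m γ) t‖ = π * √(2 * m) := by
  have hN' : (0 : ℝ) < latN m := by exact_mod_cast hN
  set D : ℤ × ℤ → ℝ := fun μ =>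
    2 * π * ((μ.1 : ℝ) * (deriv γ t).1 + (μ.2 : ℝ) * (deriv γ t).2)
  have hder : HasDerivAt (waveCurve m γ) (WithLp.toLp 2 fun i => (√(latN m))⁻¹ *
      Sum.elim (fun μ : ↥(latticeSet m) => -sin (phase γ μ t) * D μ)
        (fun μ : ↥(latticeSet m) => cos (phase γ μ t) * D μ) i) t := by
    refine ((PiLp.continuousLinearEquiv 2 ℝ
      fun _ : ↥(latticeSet m) ⊕ ↥(latticeSet m) => ℝ).symm.hasFDerivAt).comp_hasDerivAt t
      (f := fun s i => (√(latN m))⁻¹ * Sum.elim (fun μ : ↥(latticeSet m) => cos (phase γ μ s))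
        (fun μ : ↥(latticeSet m) => sin (phase γ μ s)) i) (hasDerivAt_pi.2 ?_)
    rintro (μ | μ)
    · exact (hasDerivAt_phase (hγ t) μ).cos.const_mul _
    · exact (hasDerivAt_phase (hγ t) μ).sin.const_mul _
  rw [hder.deriv, ← sq_eq_sq₀ (norm_nonneg _) (by positivity), EuclideanSpace.real_norm_sq_eq]
  simp only [Fintype.sum_sum_type, Sum.elim_inl, Sum.elim_inr]
  rw [← Finset.sum_add_distrib]
  have h1 (μ : ↥(latticeSet m)) : ((√(latN m))⁻¹ * (-sin (phase γ μ t) * D μ)) ^ 2 +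
      ((√(latN m))⁻¹ * (cos (phase γ μ t) * D μ)) ^ 2 = (latN m : ℝ)⁻¹ * (2 * π) ^ 2 *
      ((μ : ℤ × ℤ).1 * (deriv γ t).1 + (μ : ℤ × ℤ).2 * (deriv γ t).2) ^ 2 := by
    have h2 : (√(latN m : ℝ))⁻¹ ^ 2 = (latN m : ℝ)⁻¹ := by rw [inv_pow, sq_sqrt hN'.le]
    simp only [D]
    rw [← h2]
    linear_combination ((√(latN m : ℝ))⁻¹ ^ 2 * (2 * π) ^ 2 *
      ((μ : ℤ × ℤ).1 * (deriv γ t).1 + (μ : ℤ × ℤ).2 * (deriv γ t).2) ^ 2) *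
      sin_sq_add_cos_sq (phase γ μ t)
  rw [Finset.sum_congr rfl fun μ _ => h1 μ, ← Finset.mul_sum, sum_latticeSet_sq, ht, mul_pow π,
    sq_sqrt (by positivity)]
  field_simp

/-- The expected number of nodal intersections of the arithmetic random wave with a smooth
unit-speed curve with nowhere-vanishing curvature equals `√(2m)·L`. -/
theorem expected_nodal_intersections (m : ℕ) (hm : 0 < m)
    (hsq : ∃ a b : ℤ, a ^ 2 + b ^ 2 = (m : ℤ))
    (L : ℝ) (hL : 0 < L) (γ : ℝ → ℝ × ℝ) (hγ : ContDiff ℝ (⊤ : ℕ∞) γ)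
    (hunit : ∀ t ∈ Set.Icc (0:ℝ) L, (deriv γ t).1 ^ 2 + (deriv γ t).2 ^ 2 = 1)
    (hcurv : ∀ t ∈ Set.Icc (0:ℝ) L, deriv (deriv γ) t ≠ 0) :
    ∫ ω, (nodalCount m γ L ω : ℝ) ∂(waveMeasure m) = Real.sqrt (2 * m) * L := by
  have hγ2 : ContDiff ℝ 2 γ := contDiff_infty.1 hγ 2
  have hN : 0 < latN m := by
    obtain ⟨a, b, hab⟩ := hsq
    exact Finset.card_pos.2 ⟨(a, b), mem_latticeSet.2 hab⟩
  have hm' : (0 : ℝ) < m := by exact_mod_cast hm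
  obtain ⟨h1, h2⟩ := integral_ncard_zeros (contDiff_waveCurve m hγ2) (norm_waveCurve hN γ)
    (c := π * √(2 * m)) (by positivity) hL
    fun t ht => norm_deriv_waveCurve hN (hγ2.differentiable (by norm_num)) (hunit t ht)
  have hT := measurePreserving_coeffVec m
  rw [← hT.map_eq] at h1 h2
  rw [integral_map hT.measurable.aemeasurable h1] at h2
  simp only [inner_waveCurve] at h2
  rw [show √(2 * m) * L = π * √(2 * m) * L / π by field_simp, ← h2]
  rfl

end
end

section
/- For every ρ ∈ (−1,1), the absolute mixed moment of a centered bivariate Gaussian vector with unit variances and correlation ρ satisfies (2π√(1−ρ²))^{-1} ∫_ℝ ∫_ℝ |y₁ y₂| · exp( −(y₁² − 2ρ y₁ y₂ + y₂²) / (2(1−ρ²)) ) dy₁ dy₂ = (2/π) ( √(1−ρ²) + ρ · arcsin ρ ). -/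
open Real

open MeasureTheory Set Filter Topology

lemma integrable_abs_pow_three_mul_exp_neg_mul_sq {b : ℝ} (hb : 0 < b) :
    Integrable fun y : ℝ => |y| ^ 3 * exp (-b * y ^ 2) := by
  have h := (integrable_rpow_mul_exp_neg_mul_sq hb (s := (3 : ℕ)) (by norm_num)).abs
  simpa only [rpow_natCast, abs_mul, abs_pow, abs_exp] using h

lemma integral_abs_pow_three_mul_exp_neg_mul_sq {b : ℝ} (hb : 0 < b) :
    ∫ y : ℝ, |y| ^ 3 * exp (-b * y ^ 2) = 1 / b ^ 2 := by
  have h := integral_comp_abs (f := fun y : ℝ => y ^ 3 * exp (-b * y ^ 2))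
  simp only [sq_abs] at h
  have h2 := integral_rpow_mul_exp_neg_mul_rpow (p := (2 : ℕ)) (q := (3 : ℕ)) (by norm_num)
    (by norm_num) hb
  simp only [rpow_natCast] at h2
  rw [h, h2]
  have e : (((3 : ℕ) : ℝ) + 1) / ((2 : ℕ) : ℝ) = ((1 : ℕ) : ℝ) + 1 := by norm_num
  rw [neg_div, e, Gamma_nat_eq_factorial, rpow_neg hb.le, ← Nat.cast_succ, rpow_natCast]
  norm_num
  ring

section RationalIntegral

variable {r s : ℝ}

lemma sq_sub_two_mul_add_one_pos (hs : 0 < s) (h : r ^ 2 + s ^ 2 = 1) (t : ℝ) :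
    0 < t ^ 2 - 2 * r * t + 1 := by
  nlinarith [sq_nonneg (t - r), pow_pos hs 2]

lemma hasDerivAt_primitive_div_sq (hs : 0 < s) (h : r ^ 2 + s ^ 2 = 1) (t : ℝ) :
    HasDerivAt (fun t : ℝ => (r * t - 1) / (2 * s ^ 2 * (t ^ 2 - 2 * r * t + 1))
      + r / (2 * s ^ 3) * arctan ((t - r) / s)) (t / (t ^ 2 - 2 * r * t + 1) ^ 2) t := by
  have hQ := sq_sub_two_mul_add_one_pos hs h t
  have h1 : HasDerivAt (fun t : ℝ => r * t - 1) r t := by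
    simpa using ((hasDerivAt_id t).const_mul r).sub_const 1
  have h2 : HasDerivAt (fun t : ℝ => 2 * s ^ 2 * (t ^ 2 - 2 * r * t + 1))
      (2 * s ^ 2 * (2 * t - 2 * r)) t := by
    have := ((((hasDerivAt_id t).pow 2).sub ((hasDerivAt_id t).const_mul (2 * r))).add_const
      1).const_mul (2 * s ^ 2)
    simpa using this
  have h3 : HasDerivAt (fun t : ℝ => (t - r) / s) (1 / s) t :=
    ((hasDerivAt_id t).sub_const r).div_const s
  have h4 := (h1.div h2 (by positivity)).add ((h3.arctan).const_mul (r / (2 * s ^ 3)))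
  refine h4.congr_deriv ?_
  have e : 1 + ((t - r) / s) ^ 2 = (t ^ 2 - 2 * r * t + 1) / s ^ 2 := by
    field_simp
    linear_combination h
  rw [e]
  generalize hq : t ^ 2 - 2 * r * t + 1 = Q at hQ ⊢
  field_simp
  subst hq
  have e2 : s ^ 2 = 1 - r ^ 2 := by linarith
  simp only [e2]
  ring

lemma tendsto_primitive_div_sq (hs : 0 < s) :
    Tendsto (fun t : ℝ => (r * t - 1) / (2 * s ^ 2 * (t ^ 2 - 2 * r * t + 1))
      + r / (2 * s ^ 3) * arctan ((t - r) / s)) atTop (𝓝 (r / (2 * s ^ 3) * (π / 2))) := by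
  have hi : Tendsto (fun t : ℝ => t⁻¹) atTop (𝓝 0) := tendsto_inv_atTop_zero
  have h1 : Tendsto (fun t : ℝ => (r * t⁻¹ - t⁻¹ ^ 2) /
      (2 * s ^ 2 * (1 - 2 * r * t⁻¹ + t⁻¹ ^ 2))) atTop
      (𝓝 ((r * 0 - 0 ^ 2) / (2 * s ^ 2 * (1 - 2 * r * 0 + 0 ^ 2)))) := by
    refine ((hi.const_mul r).sub (hi.pow 2)).div
      (((tendsto_const_nhds.sub (hi.const_mul (2 * r))).add (hi.pow 2)).const_mul _) ?_
    simp [hs.ne']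
  have h2 : Tendsto (fun t : ℝ => (r * t - 1) / (2 * s ^ 2 * (t ^ 2 - 2 * r * t + 1)))
      atTop (𝓝 0) := by
    have e0 : (r * 0 - 0 ^ 2) / (2 * s ^ 2 * (1 - 2 * r * 0 + 0 ^ 2)) = 0 := by simp
    rw [e0] at h1
    refine h1.congr' ?_
    filter_upwards [eventually_gt_atTop 0] with t ht
    have e1 : r * t - 1 = t ^ 2 * (r * t⁻¹ - t⁻¹ ^ 2) := by field_simp
    have e2 : 2 * s ^ 2 * (t ^ 2 - 2 * r * t + 1)
        = t ^ 2 * (2 * s ^ 2 * (1 - 2 * r * t⁻¹ + t⁻¹ ^ 2)) := by field_simp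
    rw [e1, e2, mul_div_mul_left _ _ (by positivity)]
  have h3 : Tendsto (fun t : ℝ => arctan ((t - r) / s)) atTop (𝓝 (π / 2)) :=
    (tendsto_arctan_atTop.mono_right nhdsWithin_le_nhds).comp
      ((tendsto_atTop_add_const_right _ (-r) tendsto_id).atTop_div_const hs)
  simpa using h2.add (h3.const_mul (r / (2 * s ^ 3)))

lemma integrableOn_Ioi_div_sq (hs : 0 < s) (h : r ^ 2 + s ^ 2 = 1) :
    IntegrableOn (fun t : ℝ => t / (t ^ 2 - 2 * r * t + 1) ^ 2) (Ioi 0) :=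
  integrableOn_Ioi_deriv_of_nonneg' (fun t _ => hasDerivAt_primitive_div_sq hs h t)
    (fun _ ht => div_nonneg (le_of_lt ht) (sq_nonneg _)) (tendsto_primitive_div_sq hs)

lemma integral_Ioi_div_sq (hs : 0 < s) (h : r ^ 2 + s ^ 2 = 1) :
    ∫ t in Ioi (0 : ℝ), t / (t ^ 2 - 2 * r * t + 1) ^ 2
      = 1 / (2 * s ^ 2) + r / (2 * s ^ 3) * (π / 2 + arctan (r / s)) := by
  rw [integral_Ioi_of_hasDerivAt_of_nonneg' (fun t _ => hasDerivAt_primitive_div_sq hs h t)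
    (fun _ ht => div_nonneg (le_of_lt ht) (sq_nonneg _)) (tendsto_primitive_div_sq hs)]
  simp only [zero_sub, neg_div, arctan_neg]
  ring

lemma abs_div_sq_neg (t : ℝ) :
    |-t| / ((-t) ^ 2 - 2 * r * (-t) + 1) ^ 2 = |t| / (t ^ 2 - 2 * (-r) * t + 1) ^ 2 := by
  rw [abs_neg]
  ring

lemma integrable_abs_div_sq (hs : 0 < s) (h : r ^ 2 + s ^ 2 = 1) :
    Integrable (fun t : ℝ => |t| / (t ^ 2 - 2 * r * t + 1) ^ 2) := by
  rw [← integrableOn_univ, ← @Iio_union_Ici _ _ (0 : ℝ), integrableOn_union,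
    integrableOn_Ici_iff_integrableOn_Ioi]
  constructor
  · rw [← (Measure.measurePreserving_neg (volume : Measure ℝ)).integrableOn_comp_preimage
      (Homeomorph.neg ℝ).measurableEmbedding]
    simp only [Function.comp_def, abs_div_sq_neg, neg_preimage, neg_Iio, neg_zero]
    refine (integrableOn_Ioi_div_sq (r := -r) hs (by linarith [neg_sq r])).congr_fun
      (fun t ht => ?_) measurableSet_Ioi
    simp only [abs_of_pos (mem_Ioi.1 ht)]
  · refine (integrableOn_Ioi_div_sq hs h).congr_fun (fun t ht => ?_) measurableSet_Ioi
    simp only [abs_of_pos (mem_Ioi.1 ht)]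

lemma integral_abs_div_sq (hs : 0 < s) (h : r ^ 2 + s ^ 2 = 1) :
    ∫ t : ℝ, |t| / (t ^ 2 - 2 * r * t + 1) ^ 2 = 1 / s ^ 2 + r / s ^ 3 * arctan (r / s) := by
  have hIoi : ∀ r : ℝ, ∫ t in Ioi (0 : ℝ), |t| / (t ^ 2 - 2 * r * t + 1) ^ 2
      = ∫ t in Ioi (0 : ℝ), t / (t ^ 2 - 2 * r * t + 1) ^ 2 := fun r =>
    setIntegral_congr_fun measurableSet_Ioi fun t ht => by
      simp only [abs_of_pos (mem_Ioi.1 ht)]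
  have hint := integrable_abs_div_sq hs h
  rw [← intervalIntegral.integral_Iic_add_Ioi (b := 0) hint.integrableOn hint.integrableOn]
  have hneg := integral_comp_neg_Ioi 0 (fun t : ℝ => |t| / (t ^ 2 - 2 * r * t + 1) ^ 2)
  simp only [abs_div_sq_neg, neg_zero] at hneg
  rw [← hneg, hIoi, hIoi, integral_Ioi_div_sq hs h,
    integral_Ioi_div_sq (r := -r) hs (by linarith [neg_sq r]), neg_div s r, arctan_neg]
  ring

end RationalIntegral

lemma integral_abs_mul_comp_ratio (g : ℝ → ℝ → ℝ) (y : ℝ) :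
    ∫ z : ℝ, |y * z| * g y z = ∫ t : ℝ, |t| * (|y| ^ 3 * g y (y * t)) := by
  rcases eq_or_ne y 0 with rfl | hy
  · simp
  have h := Measure.integral_comp_mul_left (fun z : ℝ => |y * z| * g y z) y
  have hy' : |y| ≠ 0 := abs_ne_zero.2 hy
  have e : ∀ t : ℝ, |t| * (|y| ^ 3 * g y (y * t)) = |y| * (|y * (y * t)| * g y (y * t)) := by
    intro t
    rw [abs_mul, abs_mul]
    ring
  simp_rw [e]
  rw [integral_const_mul, h, abs_inv, smul_eq_mul, mul_inv_cancel_left₀ hy']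

/-- Absolute mixed moment of a standard bivariate Gaussian with correlation `ρ`:
`E|Y₁Y₂| = (2/π)(√(1−ρ²) + ρ·arcsin ρ)`. -/
theorem gaussian_abs_mixed_moment (ρ : ℝ) (hρ : ρ ∈ Set.Ioo (-1 : ℝ) 1) :
    (2 * π * Real.sqrt (1 - ρ ^ 2))⁻¹ *
        ∫ y₁ : ℝ, ∫ y₂ : ℝ,
          |y₁ * y₂| * Real.exp (-(y₁ ^ 2 - 2 * ρ * y₁ * y₂ + y₂ ^ 2) / (2 * (1 - ρ ^ 2)))
      = 2 / π * (Real.sqrt (1 - ρ ^ 2) + ρ * Real.arcsin ρ) := by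
  have hpos : 0 < 1 - ρ ^ 2 := by nlinarith [hρ.1, hρ.2]
  rw [arcsin_eq_arctan hρ]
  have hs : 0 < √(1 - ρ ^ 2) := sqrt_pos.2 hpos
  have hsq : √(1 - ρ ^ 2) ^ 2 = 1 - ρ ^ 2 := sq_sqrt hpos.le
  rw [← hsq]
  generalize √(1 - ρ ^ 2) = s at hs hsq
  rw [sqrt_sq hs.le]
  have h : ρ ^ 2 + s ^ 2 = 1 := by linarith
  have hQ := sq_sub_two_mul_add_one_pos hs h
  have hb : ∀ t : ℝ, 0 < (t ^ 2 - 2 * ρ * t + 1) / (2 * s ^ 2) := fun t =>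
    div_pos (hQ t) (by positivity)
  have hval : ∀ t : ℝ, |t| * (1 / ((t ^ 2 - 2 * ρ * t + 1) / (2 * s ^ 2)) ^ 2)
      = 4 * s ^ 4 * (|t| / (t ^ 2 - 2 * ρ * t + 1) ^ 2) := by
    intro t
    have := (hQ t).ne'
    field_simp
    norm_num
  let F : ℝ → ℝ → ℝ := fun y t =>
    |t| * (|y| ^ 3 * exp (-((t ^ 2 - 2 * ρ * t + 1) / (2 * s ^ 2)) * y ^ 2))
  have hF : Integrable (Function.uncurry F) (volume.prod volume) := by
    have hcont : Continuous (Function.uncurry F) := by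
      simp only [F, Function.uncurry_def]
      fun_prop
    rw [integrable_prod_iff' hcont.aestronglyMeasurable]
    refine ⟨.of_forall fun t =>
      (integrable_abs_pow_three_mul_exp_neg_mul_sq (hb t)).const_mul |t|, ?_⟩
    have hnorm : ∀ y t, ‖Function.uncurry F (y, t)‖ = F y t := fun y t =>
      norm_of_nonneg (by simp only [Function.uncurry, F]; positivity)
    simp_rw [hnorm, F, integral_const_mul, integral_abs_pow_three_mul_exp_neg_mul_sq (hb _), hval]
    exact (integrable_abs_div_sq hs h).const_mul _
  have hmain : ∀ y : ℝ, ∫ z : ℝ, |y * z| * exp (-(y ^ 2 - 2 * ρ * y * z + z ^ 2) / (2 * s ^ 2))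
      = ∫ t : ℝ, F y t := by
    intro y
    rw [integral_abs_mul_comp_ratio
      (fun y z => exp (-(y ^ 2 - 2 * ρ * y * z + z ^ 2) / (2 * s ^ 2)))]
    refine integral_congr_ae (.of_forall fun t => ?_)
    simp only [F]
    congr 3
    ring
  simp_rw [hmain]
  rw [integral_integral_swap hF]
  simp_rw [F, integral_const_mul, integral_abs_pow_three_mul_exp_neg_mul_sq (hb _), hval]
  rw [integral_const_mul, integral_abs_div_sq hs h]
  have := pi_pos
  field_simp
  norm_num
end

section
/- For every ε ∈ (0,1) there exists a constant C = C(ε) > 0 such that the following holds. Let α > 0 and let r, r₁, r₂, r₁₂ be real numbers satisfying |r| ≤ 1 − ε, α(1−r²) − r₁² > 0, α(1−r²) − r₂² > 0, and (r₁₂(1−r²) + r·r₁·r₂)² ≤ (α(1−r²) − r₁²)·(α(1−r²) − r₂²). Set μ = √(α(1−r²) − r₁²) · √(α(1−r²) − r₂²), ρ = (r₁₂(1−r²) + r·r₁·r₂)/μ, and K₂ = (π² (1−r²)^{3/2})^{-1} · μ · ( √(1−ρ²) + ρ · arcsin ρ ). Then |K₂ − (α/π²)·(1 + r²/2 − r₁²/(2α)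 − r₂²/(2α) + r₁₂²/(2α²))| ≤ C · α · ( r⁴ + (r₁²/α)² + (r₂²/α)² + (r₁₂/α)⁴ ). -/
open Real

lemma sub_sin_le_pow_three {θ : ℝ} (h : 0 ≤ θ) : θ - sin θ ≤ θ ^ 3 := by
  rcases h.eq_or_lt with rfl | h0
  · simp
  · linarith [sin_gt_sub_cube h0, pow_pos h0 3]

lemma abs_arcsin_sub_le {ρ : ℝ} (h0 : 0 ≤ ρ) (h1 : ρ ≤ 1) :
    |arcsin ρ - ρ| ≤ 8 * ρ ^ 3 := by
  have hθ : 0 ≤ arcsin ρ := arcsin_nonneg.2 h0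
  have hs : sin (arcsin ρ) = ρ := sin_arcsin (by linarith) h1
  have hle : ρ ≤ arcsin ρ := by
    have := sin_le hθ
    rwa [hs] at this
  have hcube := sub_sin_le_pow_three hθ
  have hj := mul_le_sin hθ (arcsin_le_pi_div_two ρ)
  rw [hs] at hcube hj
  have h2 : arcsin ρ ≤ 2 * ρ := by
    rw [div_mul_eq_mul_div, div_le_iff₀ pi_pos] at hj
    nlinarith [pi_lt_four]
  rw [abs_of_nonneg (by linarith)]
  calc arcsin ρ - ρ ≤ arcsin ρ ^ 3 := hcube
    _ ≤ (2 * ρ) ^ 3 := pow_le_pow_left₀ hθ h2 3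
    _ = 8 * ρ ^ 3 := by ring

lemma abs_sub_one_sub_half_le {t : ℝ} (ht : 0 ≤ t) :
    |t - 1 - (t ^ 2 - 1) / 2| ≤ (t ^ 2 - 1) ^ 2 / 2 := by
  rw [show t - 1 - (t ^ 2 - 1) / 2 = -((t - 1) ^ 2 / 2) by ring, abs_neg,
    abs_of_nonneg (by positivity)]
  have : (t ^ 2 - 1) ^ 2 = (t - 1) ^ 2 * (t + 1) ^ 2 := by ring
  rw [this]
  nlinarith [mul_nonneg (sq_nonneg (t - 1)) (by positivity : 0 ≤ t ^ 2 + 2 * t)]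

lemma abs_sqrt_add_mul_arcsin_sub_le {ρ : ℝ} (h : ρ ^ 2 ≤ 1) :
    |√(1 - ρ ^ 2) + ρ * arcsin ρ - (1 + ρ ^ 2 / 2)| ≤ 9 * ρ ^ 4 := by
  wlog h0 : 0 ≤ ρ generalizing ρ
  · have := this (ρ := -ρ) (by simpa using h) (by linarith)
    simpa [arcsin_neg, Even.neg_pow (show Even 4 by decide)] using this
  have h1 : ρ ≤ 1 := by nlinarith
  have ha := abs_arcsin_sub_le h0 h1
  have hb := abs_sub_one_sub_half_le (sqrt_nonneg (1 - ρ ^ 2))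
  rw [sq_sqrt (by linarith)] at hb
  rw [abs_le] at *
  constructor <;> nlinarith [mul_le_mul_of_nonneg_left ha.1 h0, mul_le_mul_of_nonneg_left ha.2 h0]

section Normalized

variable {D i r p v z t s n m : ℝ}

/-- The error term of the expansion, for a process normalized to `α = 1`. -/
def expansionError (r p v z : ℝ) : ℝ := r ^ 4 + p ^ 4 + v ^ 4 + z ^ 4

lemma expansionError_nonneg (r p v z : ℝ) : 0 ≤ expansionError r p v z := by
  unfold expansionError; positivity

lemma abs_sq_sub_one_le (hi : 1 ≤ i) (hiD : i ≤ D) (hp : p ^ 2 ≤ 1)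
    (ht2 : t ^ 2 - 1 = r ^ 2 * i - (p ^ 2 + v ^ 2) * i ^ 2 + p ^ 2 * v ^ 2 * i ^ 3) :
    |t ^ 2 - 1| ≤ 2 * D ^ 3 * (r ^ 2 + p ^ 2 + v ^ 2) := by
  have hD3 : i ^ 3 ≤ D ^ 3 := pow_le_pow_left₀ (by linarith) hiD 3
  have hi2 : i ^ 2 ≤ i ^ 3 := pow_le_pow_right₀ hi (by norm_num)
  have hi1 : i ≤ i ^ 3 := le_self_pow₀ hi (by norm_num)
  have hpv : p ^ 2 * v ^ 2 ≤ v ^ 2 := by nlinarith [sq_nonneg v]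
  have e1 : r ^ 2 * i ≤ r ^ 2 * D ^ 3 := by gcongr; linarith
  have e2 : (p ^ 2 + v ^ 2) * i ^ 2 ≤ (p ^ 2 + v ^ 2) * D ^ 3 := by gcongr; linarith
  have e3 : p ^ 2 * v ^ 2 * i ^ 3 ≤ v ^ 2 * D ^ 3 := by gcongr
  have f1 : 0 ≤ r ^ 2 * i := by positivity
  have f2 : 0 ≤ (p ^ 2 + v ^ 2) * i ^ 2 := by positivity
  have f3 : 0 ≤ p ^ 2 * v ^ 2 * i ^ 3 := by positivity
  have hD0 : 0 ≤ D ^ 3 := by linarith [pow_nonneg (by linarith : (0:ℝ) ≤ i) 3]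
  have g1 : 0 ≤ r ^ 2 * D ^ 3 := by positivity
  have g2 : 0 ≤ p ^ 2 * D ^ 3 := by positivity
  have g3 : 0 ≤ v ^ 2 * D ^ 3 := by positivity
  rw [ht2, abs_le]
  constructor <;> nlinarith

lemma abs_leading_sub_le (hi : 1 ≤ i) (hiD : i ≤ D) (hir : i - 1 = r ^ 2 * i) (hp : p ^ 2 ≤ 1)
    (ht : 0 ≤ t)
    (ht2 : t ^ 2 - 1 = r ^ 2 * i - (p ^ 2 + v ^ 2) * i ^ 2 + p ^ 2 * v ^ 2 * i ^ 3) :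
    |t - (1 + (r ^ 2 - p ^ 2 - v ^ 2) / 2)| ≤ 8 * D ^ 6 * expansionError r p v z := by
  have hD : 1 ≤ D := hi.trans hiD
  have hsq : (t ^ 2 - 1) ^ 2 ≤ 12 * D ^ 6 * expansionError r p v z := by
    have h1 : (t ^ 2 - 1) ^ 2 ≤ (2 * D ^ 3 * (r ^ 2 + p ^ 2 + v ^ 2)) ^ 2 :=
      sq_le_sq' (abs_le.1 (abs_sq_sub_one_le hi hiD hp ht2)).1
        (abs_le.1 (abs_sq_sub_one_le hi hiD hp ht2)).2
    have h2 : (r ^ 2 + p ^ 2 + v ^ 2) ^ 2 ≤ 3 * expansionError r p v z := by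
      unfold expansionError
      nlinarith [sq_nonneg (r ^ 2 - p ^ 2), sq_nonneg (r ^ 2 - v ^ 2), sq_nonneg (p ^ 2 - v ^ 2),
        sq_nonneg (z ^ 2)]
    calc _ ≤ _ := h1
      _ = 4 * D ^ 6 * (r ^ 2 + p ^ 2 + v ^ 2) ^ 2 := by ring
      _ ≤ 4 * D ^ 6 * (3 * expansionError r p v z) := by gcongr
      _ = _ := by ring
  have hlin : |t ^ 2 - 1 - (r ^ 2 - p ^ 2 - v ^ 2)| ≤ 4 * D ^ 3 * expansionError r p v z := by
    have key : t ^ 2 - 1 - (r ^ 2 - p ^ 2 - v ^ 2)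
        = r ^ 4 * i - (p ^ 2 + v ^ 2) * r ^ 2 * (i * (i + 1)) + p ^ 2 * v ^ 2 * i ^ 3 := by
      rw [ht2]
      linear_combination (r ^ 2 - (p ^ 2 + v ^ 2) * (i + 1)) * hir
    have hD3 : i ^ 3 ≤ D ^ 3 := pow_le_pow_left₀ (by linarith) hiD 3
    have hi2 : i ^ 2 ≤ i ^ 3 := pow_le_pow_right₀ hi (by norm_num)
    have hi1 : i ≤ i ^ 3 := le_self_pow₀ hi (by norm_num)
    have e1 : r ^ 4 * i ≤ r ^ 4 * D ^ 3 := by gcongr; linarith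
    have e2 : (p ^ 2 + v ^ 2) * r ^ 2 * (i * (i + 1)) ≤ (p ^ 2 + v ^ 2) * r ^ 2 * (2 * D ^ 3) := by
      have : i * (i + 1) ≤ 2 * D ^ 3 := by linarith
      gcongr
    have e3 : p ^ 2 * v ^ 2 * i ^ 3 ≤ p ^ 2 * v ^ 2 * D ^ 3 := by gcongr
    have f1 : 0 ≤ r ^ 4 * i := by positivity
    have f2 : 0 ≤ (p ^ 2 + v ^ 2) * r ^ 2 * (i * (i + 1)) := by positivity
    have f3 : 0 ≤ p ^ 2 * v ^ 2 * i ^ 3 := by positivity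
    have hE : r ^ 4 + 2 * (p ^ 2 + v ^ 2) * r ^ 2 + p ^ 2 * v ^ 2
        ≤ 4 * expansionError r p v z := by
      unfold expansionError
      nlinarith [sq_nonneg (r ^ 2 - p ^ 2), sq_nonneg (r ^ 2 - v ^ 2), sq_nonneg (p ^ 2 - v ^ 2),
        sq_nonneg (z ^ 2), sq_nonneg (p ^ 2), sq_nonneg (v ^ 2), sq_nonneg (r ^ 2)]
    have hE' := mul_le_mul_of_nonneg_right hE (by positivity : 0 ≤ D ^ 3)
    have g1 : 0 ≤ r ^ 4 * D ^ 3 := by positivity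
    have g2 : 0 ≤ (p ^ 2 + v ^ 2) * r ^ 2 * D ^ 3 := by positivity
    have g3 : 0 ≤ p ^ 2 * v ^ 2 * D ^ 3 := by positivity
    rw [key, abs_le]
    constructor <;> nlinarith
  have hDD : D ^ 3 * expansionError r p v z ≤ D ^ 6 * expansionError r p v z :=
    mul_le_mul_of_nonneg_right (pow_le_pow_right₀ hD (by norm_num)) (expansionError_nonneg r p v z)
  have ha := abs_sub_one_sub_half_le ht
  rw [abs_le] at *
  constructor <;> linarith

lemma abs_quadratic_sub_le (hi : 1 ≤ i) (hiD : i ≤ D) (hir : i - 1 = r ^ 2 * i) (his : i * s = 1)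
    (hs1 : s ≤ 1) (hs0 : 0 ≤ s) (hp : p ^ 2 ≤ 1) (hr : r ^ 2 ≤ 1) (ht : 1 / 2 ≤ t)
    (ht2 : t ^ 2 - 1 = r ^ 2 * i - (p ^ 2 + v ^ 2) * i ^ 2 + p ^ 2 * v ^ 2 * i ^ 3)
    (hn : n = z * s + r * p * v) :
    |n ^ 2 * i ^ 3 / (2 * t) - z ^ 2 / 2| ≤ 10 * D ^ 6 * expansionError r p v z := by
  have hD : 1 ≤ D := hi.trans hiD
  have ht0 : 0 < t := by linarith
  set E := expansionError r p v z with hEdef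
  have hE0 : 0 ≤ E := expansionError_nonneg r p v z
  have hti : |i - t| ≤ 3 * D ^ 3 * (r ^ 2 + p ^ 2 + v ^ 2) := by
    have h1 : |1 - t| ≤ |t ^ 2 - 1| := by
      rw [show t ^ 2 - 1 = -((1 - t) * (1 + t)) by ring, abs_neg, abs_mul,
        abs_of_pos (by linarith : 0 < 1 + t)]
      nlinarith [abs_nonneg (1 - t)]
    have h2 : |i - 1| ≤ D ^ 3 * (r ^ 2 + p ^ 2 + v ^ 2) := by
      rw [abs_of_nonneg (by linarith), hir]
      calc r ^ 2 * i ≤ r ^ 2 * D ^ 3 := by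
            gcongr; exact hiD.trans (le_self_pow₀ hD (by norm_num))
        _ ≤ (r ^ 2 + p ^ 2 + v ^ 2) * D ^ 3 := by
            gcongr; nlinarith [sq_nonneg p, sq_nonneg v]
        _ = _ := by ring
    calc |i - t| ≤ |i - 1| + |1 - t| := abs_sub_le _ _ _
      _ ≤ _ := by linarith [abs_sq_sub_one_le hi hiD hp ht2]
  have hz : z ^ 2 * (r ^ 2 + p ^ 2 + v ^ 2) ≤ 2 * E := by
    rw [hEdef]; unfold expansionError
    nlinarith [sq_nonneg (z ^ 2 - r ^ 2), sq_nonneg (z ^ 2 - p ^ 2), sq_nonneg (z ^ 2 - v ^ 2),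
      sq_nonneg (z ^ 2), sq_nonneg (p ^ 2), sq_nonneg (v ^ 2), sq_nonneg (r ^ 2)]
  have hcross : |2 * z * s * (r * p * v) + (r * p * v) ^ 2| ≤ 2 * E := by
    have h1 : |2 * z * s * (r * p * v)| ≤ E := by
      rw [show 2 * z * s * (r * p * v) = s * (2 * (z * r) * (p * v)) by ring, abs_mul,
        abs_of_nonneg hs0]
      have : |2 * (z * r) * (p * v)| ≤ E := by
        rw [hEdef]; unfold expansionError
        rw [abs_le]
        constructor <;>
        nlinarith [sq_nonneg (z * r - p * v), sq_nonneg (z * r + p * v), sq_nonneg (z ^ 2 - r ^ 2),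
          sq_nonneg (p ^ 2 - v ^ 2), sq_nonneg (z ^ 2), sq_nonneg (p ^ 2), sq_nonneg (v ^ 2),
          sq_nonneg (r ^ 2)]
      nlinarith [mul_le_mul_of_nonneg_right hs1 (abs_nonneg (2 * (z * r) * (p * v)))]
    have h2 : |(r * p * v) ^ 2| ≤ E := by
      rw [abs_of_nonneg (sq_nonneg _), hEdef]; unfold expansionError
      have : (r * p * v) ^ 2 ≤ p ^ 2 * v ^ 2 := by
        nlinarith [mul_nonneg (sq_nonneg (p * v)) (sub_nonneg.2 hr)]
      nlinarith [sq_nonneg (p ^ 2 - v ^ 2), sq_nonneg (z ^ 2), sq_nonneg (p ^ 2),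
        sq_nonneg (v ^ 2), sq_nonneg (r ^ 2)]
    linarith [abs_add_le (2 * z * s * (r * p * v)) ((r * p * v) ^ 2)]
  have key : n ^ 2 * i ^ 3 / (2 * t) - z ^ 2 / 2
      = (z ^ 2 * (i - t) + (2 * z * s * (r * p * v) + (r * p * v) ^ 2) * i ^ 3) / (2 * t) := by
    rw [hn]
    field_simp
    linear_combination (z ^ 2 * i * (i * s + 1)) * his
  rw [key, abs_div, abs_of_pos (by linarith : 0 < 2 * t), div_le_iff₀ (by linarith)]
  have hA : |z ^ 2 * (i - t)| ≤ 6 * D ^ 6 * E := by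
    rw [abs_mul, abs_of_nonneg (sq_nonneg z)]
    calc z ^ 2 * |i - t| ≤ z ^ 2 * (3 * D ^ 3 * (r ^ 2 + p ^ 2 + v ^ 2)) := by gcongr
      _ = 3 * D ^ 3 * (z ^ 2 * (r ^ 2 + p ^ 2 + v ^ 2)) := by ring
      _ ≤ 3 * D ^ 6 * (2 * E) := by gcongr; norm_num
      _ = _ := by ring
  have hB : |(2 * z * s * (r * p * v) + (r * p * v) ^ 2) * i ^ 3| ≤ 2 * D ^ 6 * E := by
    rw [abs_mul, abs_of_nonneg (by positivity : 0 ≤ i ^ 3)]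
    calc _ ≤ 2 * E * D ^ 6 := by
          gcongr
          calc i ^ 3 ≤ D ^ 3 := by gcongr
            _ ≤ D ^ 6 := pow_le_pow_right₀ hD (by norm_num)
      _ = _ := by ring
  have hDE : 0 ≤ D ^ 6 * E := by positivity
  calc _ ≤ _ := abs_add_le _ _
    _ ≤ 8 * D ^ 6 * E := by linarith
    _ ≤ 10 * D ^ 6 * E * (2 * t) := by nlinarith

lemma pow_four_le_expansionError (hs0 : 0 ≤ s) (hs1 : s ≤ 1) (hr : r ^ 2 ≤ 1) (hv : v ^ 2 ≤ 1)
    (hn : n = z * s + r * p * v) : n ^ 4 ≤ 16 * expansionError r p v z := by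
  have h1 : n ^ 2 ≤ 2 * z ^ 2 + 2 * (p ^ 2) := by
    have hw : (r * p * v) ^ 2 ≤ p ^ 2 := by
      calc (r * p * v) ^ 2 = r ^ 2 * v ^ 2 * p ^ 2 := by ring
        _ ≤ 1 * p ^ 2 := by gcongr; exact mul_le_one₀ hr (sq_nonneg v) hv
        _ = p ^ 2 := one_mul _
    have hz : (z * s) ^ 2 ≤ z ^ 2 := by
      rw [mul_pow]; exact mul_le_of_le_one_right (sq_nonneg z) (pow_le_one₀ hs0 hs1)
    rw [hn]; nlinarith [sq_nonneg (z * s - r * p * v)]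
  calc n ^ 4 = (n ^ 2) ^ 2 := by ring
    _ ≤ (2 * z ^ 2 + 2 * p ^ 2) ^ 2 := by gcongr
    _ ≤ 16 * expansionError r p v z := by
      unfold expansionError
      nlinarith [sq_nonneg (z ^ 2 - p ^ 2), sq_nonneg (r ^ 2), sq_nonneg (v ^ 2),
        sq_nonneg (z ^ 2), sq_nonneg (p ^ 2)]

lemma div_pow_four_le (hi0 : 0 ≤ i) (hiD : i ≤ D) (his : i * s = 1) (hm0 : 0 < m)
    (hm : s ^ 2 / 4 ≤ m ^ 2) (hn : n ^ 4 ≤ 16 * expansionError r p v z) :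
    (n / m) ^ 4 ≤ 256 * D ^ 4 * expansionError r p v z := by
  have hD0 : 0 ≤ D := hi0.trans hiD
  have hE0 := expansionError_nonneg r p v z
  have hmi : 1 ≤ 16 * i ^ 4 * m ^ 4 := by
    have h1 : (1:ℝ) ≤ 4 * i ^ 2 * m ^ 2 := by
      calc (1:ℝ) = 4 * i ^ 2 * (s ^ 2 / 4) := by linear_combination (-(i * s + 1)) * his
        _ ≤ _ := by gcongr
    nlinarith
  rw [div_pow, div_le_iff₀ (by positivity)]
  have hi4 : i ^ 4 ≤ D ^ 4 := by gcongr
  calc n ^ 4 ≤ 16 * expansionError r p v z * 1 := by linarith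
    _ ≤ 16 * expansionError r p v z * (16 * D ^ 4 * m ^ 4) := by
      gcongr
      exact hmi.trans (by gcongr)
    _ = _ := by ring

lemma sq_le_four_mul_sq (hi0 : 0 ≤ i) (hiD : i ≤ D) (his : i * s = 1) (hr1 : r ^ 2 ≤ 1)
    (hp1 : p ^ 2 ≤ 1) (hv1 : v ^ 2 ≤ 1) (hn1 : n ^ 2 ≤ 1) (hn : n = z * s + r * p * v) :
    z ^ 2 ≤ 4 * D ^ 2 := by
  have h1 : (z * s) ^ 2 ≤ 4 := by
    have hw : (r * p * v) ^ 2 ≤ 1 := by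
      rw [mul_pow, mul_pow]
      exact mul_le_one₀ (mul_le_one₀ hr1 (sq_nonneg _) hp1) (sq_nonneg _) hv1
    rw [show z * s = n - r * p * v by rw [hn]; ring]
    nlinarith [sq_nonneg (n + r * p * v)]
  calc z ^ 2 = (z * s) ^ 2 * i ^ 2 := by linear_combination (-z ^ 2 * (i * s + 1)) * his
    _ ≤ 4 * D ^ 2 := by gcongr

lemma abs_sqrt_add_mul_arcsin_le {ρ : ℝ} (h : ρ ^ 2 ≤ 1) :
    |√(1 - ρ ^ 2) + ρ * arcsin ρ| ≤ 11 := by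
  have hg := abs_le.1 (abs_sqrt_add_mul_arcsin_sub_le h)
  have h4 : ρ ^ 4 ≤ 1 := by
    rw [show ρ ^ 4 = (ρ ^ 2) ^ 2 by ring]
    exact pow_le_one₀ (sq_nonneg ρ) h
  rw [abs_le]
  constructor <;> linarith [hg.1, hg.2, sq_nonneg ρ]

end Normalized

/-- The expansion for a process normalized to `α = 1`. -/
lemma normalized_expansion {D i r p v z t s n m q : ℝ} (hs : s = 1 - r ^ 2) (hs0 : 0 < s)
    (his : i * s = 1) (hiD : i ≤ D) (hp : p ^ 2 < s) (hv : v ^ 2 < s)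
    (hm0 : 0 < m) (hm : m ^ 2 = (s - p ^ 2) * (s - v ^ 2)) (hq0 : 0 < q) (hq : q ^ 2 = s ^ 3)
    (hn : n = z * s + r * p * v) (hnm : n ^ 2 ≤ m ^ 2) (ht : t = m / q) :
    |t * (√(1 - (n / m) ^ 2) + n / m * arcsin (n / m))
        - (1 + r ^ 2 / 2 - p ^ 2 / 2 - v ^ 2 / 2 + z ^ 2 / 2)|
      ≤ 40000 * D ^ 6 * expansionError r p v z := by
  have hr1 : r ^ 2 ≤ 1 := by linarith
  have hs1 : s ≤ 1 := by linarith [sq_nonneg r]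
  have hi0 : 0 < i := pos_of_mul_pos_left (by rw [his]; norm_num) hs0.le
  have hi : 1 ≤ i := by nlinarith
  have hD : 1 ≤ D := hi.trans hiD
  have hir : i - 1 = r ^ 2 * i := by rw [hs] at his; linarith
  have hp1 : p ^ 2 ≤ 1 := by linarith
  have hv1 : v ^ 2 ≤ 1 := by linarith
  have ht0 : 0 < t := ht ▸ div_pos hm0 hq0
  have hts : t ^ 2 = m ^ 2 * i ^ 3 := by
    have hi3 : i ^ 3 * s ^ 3 = 1 := by rw [← mul_pow, his, one_pow]
    rw [ht, div_pow, hq, div_eq_iff (by positivity), mul_assoc, hi3, mul_one]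
  have ht2 : t ^ 2 - 1 = r ^ 2 * i - (p ^ 2 + v ^ 2) * i ^ 2 + p ^ 2 * v ^ 2 * i ^ 3 := by
    rw [hts, hm]
    linear_combination (i * (i * s + 1) - (p ^ 2 + v ^ 2) * i ^ 2) * his + hir
  set E := expansionError r p v z with hEdef
  have hE0 : 0 ≤ E := expansionError_nonneg r p v z
  have hms : m ^ 2 ≤ s ^ 2 := by
    rw [hm]; nlinarith [sq_nonneg p, sq_nonneg v]
  have htD : t ≤ D := by
    have : t ^ 2 ≤ D ^ 2 := by
      calc t ^ 2 ≤ s ^ 2 * i ^ 3 := by rw [hts]; gcongr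
        _ = i := by linear_combination (i * (i * s + 1)) * his
        _ ≤ D ^ 2 := hiD.trans (le_self_pow₀ hD two_ne_zero)
    exact abs_le_of_sq_le_sq' this (by linarith) |>.2
  set ρ := n / m with hρ
  have hρ1 : ρ ^ 2 ≤ 1 := by
    rw [hρ, div_pow]; exact (div_le_one (by positivity)).2 hnm
  have hg := abs_sqrt_add_mul_arcsin_sub_le hρ1
  set g := √(1 - ρ ^ 2) + ρ * arcsin ρ with hgdef
  by_cases hc : p ^ 2 ≤ s / 2 ∧ v ^ 2 ≤ s / 2
  · obtain ⟨hc1, hc2⟩ := hc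
    have hmlow : s ^ 2 / 4 ≤ m ^ 2 := by
      rw [hm, show s ^ 2 / 4 = s / 2 * (s / 2) by ring]
      gcongr <;> linarith
    have htlow : 1 / 2 ≤ t := by
      have : (1 / 2) ^ 2 ≤ t ^ 2 := by
        calc (1 / 2 : ℝ) ^ 2 ≤ i / 4 := by linarith
          _ = s ^ 2 / 4 * i ^ 3 := by linear_combination (-(i * (i * s + 1)) / 4) * his
          _ ≤ t ^ 2 := by rw [hts]; gcongr
      exact abs_le_of_sq_le_sq' this ht0.le |>.2
    have hL := abs_leading_sub_le (z := z) hi hiD hir hp1 ht0.le ht2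
    have hQ := abs_quadratic_sub_le hi hiD hir his hs1 hs0.le hp1 hr1 htlow ht2 hn
    have hquad : t * (ρ ^ 2 / 2) = n ^ 2 * i ^ 3 / (2 * t) := by
      rw [eq_div_iff (by positivity), hρ, div_pow]
      field_simp
      linear_combination (n ^ 2) * hts
    have hn4 := pow_four_le_expansionError hs0.le hs1 hr1 hv1 hn
    have hρ4 := div_pow_four_le hi0.le hiD his hm0 hmlow hn4
    have hrem : |t * (g - (1 + ρ ^ 2 / 2))| ≤ 2304 * D ^ 6 * E := by
      rw [abs_mul, abs_of_pos ht0]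
      calc t * |g - (1 + ρ ^ 2 / 2)| ≤ D * (9 * (256 * D ^ 4 * E)) := by
            gcongr; linarith
        _ = 2304 * D ^ 5 * E := by ring
        _ ≤ 2304 * D ^ 6 * E := by gcongr; norm_num
    have hsplit : t * g - (1 + r ^ 2 / 2 - p ^ 2 / 2 - v ^ 2 / 2 + z ^ 2 / 2)
        = t * (g - (1 + ρ ^ 2 / 2)) + (t - (1 + (r ^ 2 - p ^ 2 - v ^ 2) / 2))
          + (n ^ 2 * i ^ 3 / (2 * t) - z ^ 2 / 2) := by
      rw [← hquad]; ring
    have hDE : 0 ≤ D ^ 6 * E := by positivity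
    rw [hsplit]
    refine (abs_add_three _ _ _).trans ?_
    linarith
  · have hElow : 1 ≤ 4 * D ^ 2 * E := by
      have h1 : s ^ 2 / 4 ≤ E := by
        rw [hEdef]; unfold expansionError
        rw [not_and_or, not_le, not_le] at hc
        have hx {x : ℝ} (h : s / 2 < x ^ 2) : s ^ 2 / 4 ≤ x ^ 4 := by
          calc s ^ 2 / 4 = (s / 2) ^ 2 := by ring
            _ ≤ (x ^ 2) ^ 2 := by gcongr
            _ = x ^ 4 := by ring
        have hr4 : 0 ≤ r ^ 4 := by positivity
        have hp4 : 0 ≤ p ^ 4 := by positivity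
        have hv4 : 0 ≤ v ^ 4 := by positivity
        have hz4 : 0 ≤ z ^ 4 := by positivity
        rcases hc with hc | hc <;> linarith [hx hc]
      calc (1:ℝ) = 4 * i ^ 2 * (s ^ 2 / 4) := by linear_combination (-(i * s + 1)) * his
        _ ≤ 4 * D ^ 2 * E := by gcongr
    have hn1 : n ^ 2 ≤ 1 := hnm.trans (hms.trans (pow_le_one₀ hs0.le hs1))
    have hz := sq_le_four_mul_sq hi0.le hiD his hr1 hp1 hv1 hn1 hn
    have hg11 : |g| ≤ 11 := abs_sqrt_add_mul_arcsin_le hρ1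
    have htg : |t * g| ≤ 11 * D ^ 2 := by
      rw [abs_mul, abs_of_pos ht0]
      calc t * |g| ≤ D * 11 := by gcongr
        _ ≤ 11 * D ^ 2 := by linarith [le_self_pow₀ hD two_ne_zero]
    have hbd : |t * g - (1 + r ^ 2 / 2 - p ^ 2 / 2 - v ^ 2 / 2 + z ^ 2 / 2)| ≤ 16 * D ^ 2 := by
      have : 1 ≤ D ^ 2 := one_le_pow₀ hD
      rw [abs_le] at htg ⊢
      constructor <;> linarith [htg.1, htg.2, sq_nonneg r, sq_nonneg p, sq_nonneg v, sq_nonneg z]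
    calc _ ≤ 16 * D ^ 2 * 1 := by linarith
      _ ≤ 16 * D ^ 2 * (4 * D ^ 2 * E) := by gcongr
      _ = 64 * D ^ 4 * E := by ring
      _ ≤ 40000 * D ^ 6 * E := by gcongr <;> norm_num

/-- Uniform asymptotic expansion of the two-point correlation function `K₂`. -/
theorem two_point_correlation_expansion :
    ∀ ε ∈ Set.Ioo (0:ℝ) 1, ∃ C > 0, ∀ α r r₁ r₂ r₁₂ : ℝ,
      0 < α → |r| ≤ 1 - ε →
      0 < α * (1 - r ^ 2) - r₁ ^ 2 →
      0 < α * (1 - r ^ 2) - r₂ ^ 2 →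
      (r₁₂ * (1 - r ^ 2) + r * r₁ * r₂) ^ 2
        ≤ (α * (1 - r ^ 2) - r₁ ^ 2) * (α * (1 - r ^ 2) - r₂ ^ 2) →
      (let μv : ℝ := Real.sqrt (α * (1 - r ^ 2) - r₁ ^ 2) * Real.sqrt (α * (1 - r ^ 2) - r₂ ^ 2)
       let ρv : ℝ := (r₁₂ * (1 - r ^ 2) + r * r₁ * r₂) / μv
       let K₂ : ℝ := (π ^ 2 * (1 - r ^ 2) ^ ((3:ℝ)/2))⁻¹ * μv *
         (Real.sqrt (1 - ρv ^ 2) + ρv * Real.arcsin ρv)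
       |K₂ - α / π ^ 2 *
           (1 + r ^ 2 / 2 - r₁ ^ 2 / (2 * α) - r₂ ^ 2 / (2 * α) + r₁₂ ^ 2 / (2 * α ^ 2))|
         ≤ C * α * (r ^ 4 + (r₁ ^ 2 / α) ^ 2 + (r₂ ^ 2 / α) ^ 2 + (r₁₂ / α) ^ 4)) := by
  rintro ε ⟨hε0, hε1⟩
  refine ⟨40000 * ε⁻¹ ^ 6, by positivity, ?_⟩
  intro α r r₁ r₂ r₁₂ hα hr h1 h2 h12 μv ρv K₂
  obtain ⟨A, hA, rfl⟩ : ∃ A : ℝ, 0 < A ∧ α = A ^ 2 := ⟨√α, sqrt_pos.2 hα, (sq_sqrt hα.le).symm⟩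
  obtain ⟨p, rfl⟩ : ∃ p, r₁ = A * p := ⟨r₁ / A, by field_simp⟩
  obtain ⟨v, rfl⟩ : ∃ v, r₂ = A * v := ⟨r₂ / A, by field_simp⟩
  obtain ⟨z, rfl⟩ : ∃ z, r₁₂ = A ^ 2 * z := ⟨r₁₂ / A ^ 2, by field_simp⟩
  have hr2 : r ^ 2 ≤ (1 - ε) ^ 2 := sq_le_sq' (abs_le.1 hr).1 (abs_le.1 hr).2
  obtain ⟨s, hs⟩ : ∃ s, s = 1 - r ^ 2 := ⟨_, rfl⟩
  have hεs : ε ≤ s := by nlinarith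
  have hs0 : 0 < s := hε0.trans_le hεs
  rw [← hs] at h1 h2 h12
  have hp : p ^ 2 < s := by
    have : 0 < A ^ 2 * (s - p ^ 2) := by linarith
    linarith [pos_of_mul_pos_right this hα.le]
  have hv : v ^ 2 < s := by
    have : 0 < A ^ 2 * (s - v ^ 2) := by linarith
    linarith [pos_of_mul_pos_right this hα.le]
  set m := √(s - p ^ 2) * √(s - v ^ 2) with hmdef
  have hm0 : 0 < m := mul_pos (sqrt_pos.2 (by linarith)) (sqrt_pos.2 (by linarith))
  have hm : m ^ 2 = (s - p ^ 2) * (s - v ^ 2) := by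
    rw [hmdef, mul_pow, sq_sqrt (by linarith), sq_sqrt (by linarith)]
  have hμ : μv = A ^ 2 * m := by
    have h (x : ℝ) : √(A ^ 2 * (1 - r ^ 2) - (A * x) ^ 2) = A * √(s - x ^ 2) := by
      rw [show A ^ 2 * (1 - r ^ 2) - (A * x) ^ 2 = A ^ 2 * (s - x ^ 2) by rw [hs]; ring,
        sqrt_mul (sq_nonneg A), sqrt_sq hA.le]
    simp only [μv, h, hmdef]
    ring
  set q := s ^ ((3:ℝ) / 2) with hqdef
  have hq0 : 0 < q := rpow_pos_of_pos hs0 _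
  have hq : q ^ 2 = s ^ 3 := by
    rw [hqdef, ← rpow_natCast, ← rpow_mul hs0.le, ← rpow_natCast]
    norm_num
  have hρ : ρv = (z * s + r * p * v) / m := by
    simp only [ρv, hμ]
    rw [← hs, show A ^ 2 * z * s + r * (A * p) * (A * v) = A ^ 2 * (z * s + r * p * v) by ring,
      mul_div_mul_left _ _ hα.ne']
  have hnm : (z * s + r * p * v) ^ 2 ≤ m ^ 2 := by
    rw [hm]
    refine le_of_mul_le_mul_left ?_ (by positivity : 0 < A ^ 4)
    linarith
  have hmain := normalized_expansion hs hs0 (inv_mul_cancel₀ hs0.ne')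
    (inv_anti₀ hε0 hεs) hp hv hm0 hm hq0 hq rfl hnm rfl
  rw [← hρ] at hmain
  have hK : K₂ - A ^ 2 / π ^ 2 * (1 + r ^ 2 / 2 - (A * p) ^ 2 / (2 * A ^ 2)
        - (A * v) ^ 2 / (2 * A ^ 2) + (A ^ 2 * z) ^ 2 / (2 * (A ^ 2) ^ 2))
      = A ^ 2 / π ^ 2 * (m / q * (√(1 - ρv ^ 2) + ρv * arcsin ρv)
        - (1 + r ^ 2 / 2 - p ^ 2 / 2 - v ^ 2 / 2 + z ^ 2 / 2)) := by
    simp only [K₂, hμ, ← hs, ← hqdef]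
    field_simp
  have hE : r ^ 4 + ((A * p) ^ 2 / A ^ 2) ^ 2 + ((A * v) ^ 2 / A ^ 2) ^ 2
      + (A ^ 2 * z / A ^ 2) ^ 4 = expansionError r p v z := by
    unfold expansionError
    field_simp
  have hπ : A ^ 2 / π ^ 2 ≤ A ^ 2 :=
    div_le_self (sq_nonneg A) (one_le_pow₀ (by linarith [pi_gt_three]))
  rw [hK, hE, abs_mul, abs_of_nonneg (by positivity : 0 ≤ A ^ 2 / π ^ 2)]
  calc _ ≤ A ^ 2 * (40000 * ε⁻¹ ^ 6 * expansionError r p v z) := by gcongr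
    _ = _ := by ring
end
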